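/- For all n ≥ 3, with ℓ = n(n−1)/2, the expected number of positions supporting a commutation in a uniformly random reduced word for the longest element w₀ ∈ S_n equals ℓ − 1 − (1/(3ℓ·2^{2n−7})) · ∑_{j=1}^{n−2} [(2j−1)!!/(j−1)!] · [(2j+1)!!/j!] · [(2n−2j−3)!!/(n−j−2)!] · [(2n−2j−1)!!/(n−j−1)!]. Equivalently, as a counting identity: the sum over all reduced words of w₀ of the number of positions supporting a commutation equals that value multiplied by the number of reduced words of w₀. -/

import Mathlib

open scoped Classical


/-- The adjacent transposition `sᵢ ∈ S_n` swapping `i` and `i+1` (one-based),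
for `i ∈ {1, …, n-1}`; junk value `1` otherwise. -/
def simpleRefl (n i : ℕ) : Equiv.Perm (Fin n) :=
  if h : 1 ≤ i ∧ i < n then Equiv.swap ⟨i - 1, by omega⟩ ⟨i, h.2⟩ else 1

/-- The product `s_{i₁} ⋯ s_{i_m}` of the word `i₁ ⋯ i_m`. -/
def wordProd (n : ℕ) (l : List ℕ) : Equiv.Perm (Fin n) :=
  (l.map (simpleRefl n)).prod

/-- `l` is a word for `w`: letters in `{1, …, n-1}` and product `w`. -/
def IsWordFor (n : ℕ) (w : Equiv.Perm (Fin n)) (l : List ℕ) : Prop :=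
  (∀ i ∈ l, 1 ≤ i ∧ i ≤ n - 1) ∧ wordProd n l = w

/-- `l` is a reduced word for `w`: a word for `w` of minimal length. -/
def IsReducedWordFor (n : ℕ) (w : Equiv.Perm (Fin n)) (l : List ℕ) : Prop :=
  IsWordFor n w l ∧ ∀ l', IsWordFor n w l' → l.length ≤ l'.length

/-- The longest element `w₀ ∈ S_n`, `w₀(i) = n + 1 - i` in one-line notation. -/
def w₀ (n : ℕ) : Equiv.Perm (Fin n) := Fin.revPerm

/-- The number of positions of the word `l` supporting a commutation,
i.e. positions `k` with `|i_k - i_{k+1}| > 1`. -/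
def commCount (l : List ℕ) : ℕ :=
  ((Finset.range (l.length - 1)).filter
    (fun k => 1 < |(l.getD k 0 : ℤ) - (l.getD (k+1) 0 : ℤ)|)).card

/-- The number of consecutive noncommuting pairs in the word `l`,
i.e. positions `k` with `|i_k - i_{k+1}| = 1`. -/
def noncommCount (l : List ℕ) : ℕ :=
  ((Finset.range (l.length - 1)).filter
    (fun k => |(l.getD k 0 : ℤ) - (l.getD (k+1) 0 : ℤ)| = 1)).card

/-- The number of positions of `l` supporting a long braid move, i.e. positions `k`
with `(i_k, i_{k+1}, i_{k+2})` of the form `(i, i+1, i)` or `(i+1, i, i+1)`. -/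
noncomputable def braidCount (l : List ℕ) : ℕ :=
  ((Finset.range (l.length - 2)).filter
    (fun k => ∃ i : ℕ,
      (l.getD k 0, l.getD (k+1) 0, l.getD (k+2) 0) = (i, i+1, i) ∨
      (l.getD k 0, l.getD (k+1) 0, l.getD (k+2) 0) = (i+1, i, i+1))).card

section

open MvPolynomial Equiv

/-- The number of inversions of a permutation. -/
def invCount {n : ℕ} (w : Perm (Fin n)) : ℕ :=
  (Finset.univ.filter (fun p : Fin n × Fin n => p.1 < p.2 ∧ w p.2 < w p.1)).card

lemma swap_adjacent_lt {n : ℕ} {i j : Fin n} (hij : i.val + 1 = j.val) {a b : Fin n}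
    (hab : a < b) (hne : ¬ (a = i ∧ b = j)) : swap i j a < swap i j b := by
  simp only [swap_apply_def]
  rw [Fin.lt_def] at hab
  simp only [Fin.ext_iff] at hne ⊢
  split_ifs <;> rw [Fin.lt_def] <;> omega

lemma invCount_mul_swap {n : ℕ} (w : Perm (Fin n)) {i j : Fin n} (hij : i.val + 1 = j.val)
    (h : w i < w j) : invCount (w * swap i j) = invCount w + 1 := by
  have hlt : i < j := by rw [Fin.lt_def]; omega
  unfold invCount
  have hmem : (i, j) ∈ Finset.univ.filter
      (fun p : Fin n × Fin n => p.1 < p.2 ∧ (w * swap i j) p.2 < (w * swap i j) p.1) := by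
    simp only [Finset.mem_filter, Finset.mem_univ, true_and]
    simp [hlt, h]
  rw [← Finset.card_erase_add_one hmem]
  congr 1
  refine Finset.card_nbij' (fun p => (swap i j p.1, swap i j p.2))
    (fun p => (swap i j p.1, swap i j p.2)) ?_ ?_ ?_ ?_
  · rintro ⟨a, b⟩ hp
    simp only [Finset.mem_coe, Finset.mem_erase, Finset.mem_filter, Finset.mem_univ, true_and,
      ne_eq, Prod.mk.injEq] at hp ⊢
    exact ⟨swap_adjacent_lt hij hp.2.1 hp.1, hp.2.2⟩
  · rintro ⟨a, b⟩ hp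
    simp only [Finset.mem_coe, Finset.mem_erase, Finset.mem_filter, Finset.mem_univ, true_and,
      ne_eq, Prod.mk.injEq] at hp ⊢
    have hne : ¬ (a = i ∧ b = j) := by
      rintro ⟨rfl, rfl⟩
      exact absurd hp.2 (not_lt.mpr h.le)
    refine ⟨?_, swap_adjacent_lt hij hp.1 hne, by simpa using hp.2⟩
    rintro ⟨h1, h2⟩
    have ha : a = j := by rw [← swap_apply_self i j a, h1, swap_apply_left]
    have hb : b = i := by rw [← swap_apply_self i j b, h2, swap_apply_right]
    subst ha hb
    exact absurd hp.1 (not_lt.mpr hlt.le)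
  · rintro ⟨a, b⟩ _
    simp
  · rintro ⟨a, b⟩ _
    simp

lemma invCount_mul_swap_of_gt {n : ℕ} (w : Perm (Fin n)) {i j : Fin n}
    (hij : i.val + 1 = j.val) (h : w j < w i) :
    invCount w = invCount (w * swap i j) + 1 := by
  rw [← invCount_mul_swap (w * swap i j) hij (by simpa using h)]
  simp [mul_assoc]

lemma invCount_le {n : ℕ} (w : Perm (Fin n)) : invCount w ≤ n * n :=
  (Finset.card_le_univ _).trans (by simp)

lemma eq_one_of_invCount_eq_zero {n : ℕ} {w : Perm (Fin n)} (h : invCount w = 0) : w = 1 := by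
  have hm : StrictMono w := by
    intro a b hab
    by_contra hlt
    have hlt' : w b < w a := lt_of_le_of_ne (not_lt.mp hlt) (fun e => hab.ne' (w.injective e))
    rw [invCount, Finset.card_eq_zero, Finset.filter_eq_empty_iff] at h
    exact h (Finset.mem_univ (a, b)) ⟨hab, hlt'⟩
  ext x
  have := (StrictMono.range_inj (f := w) (g := id) hm strictMono_id).mp
    (by rw [w.surjective.range_eq]; simp)
  rw [this]; rfl

lemma invCount_one {n : ℕ} : invCount (1 : Perm (Fin n)) = 0 := by
  rw [invCount, Finset.card_eq_zero, Finset.filter_eq_empty_iff]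
  rintro ⟨a, b⟩ _ ⟨h1, h2⟩
  exact absurd h1 (not_lt.mpr h2.le)

lemma eq_revPerm_of_forall_descent {n : ℕ} {w : Perm (Fin n)}
    (h : ∀ i j : Fin n, i.val + 1 = j.val → w j < w i) : w = Fin.revPerm := by
  have hm : StrictAnti w := by
    cases n with
    | zero => intro a; exact a.elim0
    | succ n =>
      rw [Fin.strictAnti_iff_succ_lt]
      intro i
      exact h _ _ (by simp)
  have hm' : StrictMono (w ∘ Fin.rev) := fun a b hab => hm (Fin.rev_lt_rev.mpr hab)
  have := (StrictMono.range_inj (f := w ∘ Fin.rev) (g := id) hm' strictMono_id).mp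
    (by rw [(w.surjective.comp Fin.rev_surjective).range_eq]; simp)
  ext x
  have hx := congrFun this (Fin.rev x)
  simp only [Function.comp_apply, Fin.rev_rev, id] at hx
  rw [hx]; rfl

lemma invCount_revPerm (n : ℕ) :
    invCount (Fin.revPerm : Perm (Fin n)) = ∑ i : Fin n, (n - 1 - i.val) := by
  have : (Finset.univ.filter (fun p : Fin n × Fin n =>
      p.1 < p.2 ∧ Fin.revPerm p.2 < Fin.revPerm p.1)) =
      (Finset.univ.sigma (fun i : Fin n => Finset.Ioi i)).image (fun p => (p.1, p.2)) := by
    ext ⟨a, b⟩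
    simp
  rw [invCount, this, Finset.card_image_of_injective, Finset.card_sigma]
  · simp
  · rintro ⟨a, b⟩ ⟨c, d⟩ h
    simpa using h

lemma sum_staircase (n : ℕ) : ∑ i : Fin n, (n - 1 - i.val) = n * (n - 1) / 2 := by
  rw [Fin.sum_univ_eq_sum_range (fun i => n - 1 - i), Finset.sum_range_reflect (fun i => i),
    Finset.sum_range_id]

/-- `d` is the divided difference `(p - s p) / (xᵢ - xⱼ)`, where `s` swaps the variables `xᵢ`
and `xⱼ`. -/
def IsDivDiff {n : ℕ} (i j : Fin n) (p d : MvPolynomial (Fin n) ℚ) : Prop :=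
  (X i - X j) * d = p - rename (swap i j) p

lemma X_sub_X_ne_zero {n : ℕ} {i j : Fin n} (h : i ≠ j) :
    (X i - X j : MvPolynomial (Fin n) ℚ) ≠ 0 :=
  sub_ne_zero.mpr (fun e => h (X_injective e))

lemma rename_swap_rename_swap {n : ℕ} (i j : Fin n) (p : MvPolynomial (Fin n) ℚ) :
    rename (swap i j) (rename (swap i j) p) = p := by
  rw [rename_rename]
  have : (swap i j : Fin n → Fin n) ∘ swap i j = id := by ext; simp
  rw [this, rename_id_apply]

lemma IsDivDiff.unique {n : ℕ} {i j : Fin n} (hij : i ≠ j) {p d e : MvPolynomial (Fin n) ℚ}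
    (hd : IsDivDiff i j p d) (he : IsDivDiff i j p e) : d = e :=
  mul_left_cancel₀ (X_sub_X_ne_zero hij) (hd.trans he.symm)

lemma IsDivDiff.rename_eq {n : ℕ} {i j : Fin n} (hij : i ≠ j) {p d : MvPolynomial (Fin n) ℚ}
    (hd : IsDivDiff i j p d) : rename (swap i j) d = d := by
  apply mul_left_cancel₀ (X_sub_X_ne_zero hij)
  have h := congrArg (rename (swap i j)) hd
  simp only [map_mul, map_sub, rename_X, swap_apply_left, swap_apply_right,
    rename_swap_rename_swap] at h
  unfold IsDivDiff at hd
  linear_combination -h - hd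

lemma isDivDiff_zero_iff {n : ℕ} {i j : Fin n} {p : MvPolynomial (Fin n) ℚ} :
    IsDivDiff i j p 0 ↔ rename (swap i j) p = p := by
  rw [IsDivDiff, mul_zero, eq_comm, sub_eq_zero, eq_comm]

lemma IsDivDiff.commute {n : ℕ} {i j k l : Fin n} (hij : i ≠ j) (hkl : k ≠ l) (hik : i ≠ k)
    (hil : i ≠ l) (hjk : j ≠ k) (hjl : j ≠ l) {p a b a' b' : MvPolynomial (Fin n) ℚ}
    (h1 : IsDivDiff i j p a) (h2 : IsDivDiff k l a b)
    (h3 : IsDivDiff k l p a') (h4 : IsDivDiff i j a' b') : b = b' := by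
  have e1 := congrArg (rename (swap k l)) h1
  have e3 := congrArg (rename (swap i j)) h3
  have hc : rename (swap k l) (rename (swap i j) p) = rename (swap i j) (rename (swap k l) p) := by
    rw [rename_rename, rename_rename]
    congr 2
    ext x
    simp only [Function.comp_apply, swap_apply_def]
    split_ifs <;> simp_all
  simp only [map_mul, map_sub, rename_X, swap_apply_of_ne_of_ne hik hil,
    swap_apply_of_ne_of_ne hjk hjl, swap_apply_of_ne_of_ne hik.symm hjk.symm,
    swap_apply_of_ne_of_ne hil.symm hjl.symm, hc] at e1 e3
  apply mul_left_cancel₀ (X_sub_X_ne_zero hkl)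
  apply mul_left_cancel₀ (X_sub_X_ne_zero hij)
  unfold IsDivDiff at h1 h2 h3 h4
  linear_combination (X i - X j) * h2 - (X k - X l) * h4 + h1 - h3 - e1 + e3

lemma IsDivDiff.antisymmetrize {n : ℕ} {i j k : Fin n} (hij : i ≠ j) (hjk : j ≠ k) (hik : i ≠ k)
    {p a b c : MvPolynomial (Fin n) ℚ}
    (h1 : IsDivDiff i j p a) (h2 : IsDivDiff j k a b) (h3 : IsDivDiff i j b c) :
    (X i - X j) * (X j - X k) * (X i - X k) * c =
      p - rename (swap i j) p - rename (swap j k) p + rename (swap j k) (rename (swap i j) p)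
        + rename (swap i j) (rename (swap j k) p)
        - rename (swap i j) (rename (swap j k) (rename (swap i j) p)) := by
  have ha := h1.rename_eq hij
  have e2 := congrArg (rename (swap i j)) h2
  have e1 := congrArg (rename (swap j k)) h1
  have e11 := congrArg (rename (swap i j)) e1
  simp only [map_mul, map_sub, rename_X, swap_apply_left, swap_apply_right, ha,
    swap_apply_of_ne_of_ne hij hik, swap_apply_of_ne_of_ne hik.symm hjk.symm] at e2 e1 e11
  unfold IsDivDiff at h1 h2 h3
  linear_combination (X j - X k) * (X i - X k) * h3 + (X i - X k) * h2 - (X j - X k) * e2 +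
    h1 - e1 + e11

lemma IsDivDiff.braid {n : ℕ} {i j k : Fin n} (hij : i ≠ j) (hjk : j ≠ k) (hik : i ≠ k)
    {p a b c a' b' c' : MvPolynomial (Fin n) ℚ}
    (h1 : IsDivDiff i j p a) (h2 : IsDivDiff j k a b) (h3 : IsDivDiff i j b c)
    (h1' : IsDivDiff j k p a') (h2' : IsDivDiff i j a' b') (h3' : IsDivDiff j k b' c') :
    c = c' := by
  have h := IsDivDiff.antisymmetrize hij hjk hik h1 h2 h3
  have flip : ∀ {x y : Fin n} {q d : MvPolynomial (Fin n) ℚ}, IsDivDiff x y q d →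
      IsDivDiff y x q (-d) := by
    intro x y q d hd
    unfold IsDivDiff at hd ⊢
    rw [swap_comm]
    linear_combination hd
  have neg : ∀ {x y : Fin n} {q d : MvPolynomial (Fin n) ℚ}, IsDivDiff x y q d →
      IsDivDiff x y (-q) (-d) := by
    intro x y q d hd
    unfold IsDivDiff at hd ⊢
    rw [map_neg]
    linear_combination -hd
  have h' := IsDivDiff.antisymmetrize hjk.symm hij.symm hik.symm (flip h1') (neg (flip h2'))
    (c := -c') (by rw [neg_neg]; exact flip h3')
  have hc : rename (swap i j) (rename (swap j k) (rename (swap i j) p)) =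
      rename (swap j k) (rename (swap i j) (rename (swap j k) p)) := by
    simp only [rename_rename, ← Perm.coe_mul, ← mul_assoc]
    rw [swap_mul_swap_mul_swap hij hik, swap_comm i j, swap_comm j k,
      swap_mul_swap_mul_swap hjk.symm hik.symm, swap_comm i k]
  rw [swap_comm k j, swap_comm j i] at h'
  apply mul_left_cancel₀ (X_sub_X_ne_zero hik)
  apply mul_left_cancel₀ (X_sub_X_ne_zero hjk)
  apply mul_left_cancel₀ (X_sub_X_ne_zero hij)
  linear_combination h - h' - hc

/-- The staircase exponent `(n - 1, n - 2, …, 0)`. -/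
noncomputable def staircase (n : ℕ) : Fin n →₀ ℕ :=
  Finsupp.equivFunOnFinite.symm (fun i => n - 1 - i.val)

@[simp] lemma staircase_apply (n : ℕ) (i : Fin n) : staircase n i = n - 1 - i.val := rfl

/-- Homogeneous polynomials of degree `m` all of whose exponents lie below the staircase. -/
noncomputable def subStaircase (n m : ℕ) : Submodule ℚ (MvPolynomial (Fin n) ℚ) :=
  Submodule.span ℚ {p | ∃ α : Fin n →₀ ℕ, α ≤ staircase n ∧ ∑ i, α i = m ∧ p = monomial α 1}

lemma rename_swap_monomial {n : ℕ} (i j : Fin n) (α : Fin n →₀ ℕ) (c : ℚ) :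
    rename (swap i j) (monomial α c) = monomial (α.equivMapDomain (swap i j)) c := by
  rw [rename_monomial, Finsupp.equivMapDomain_eq_mapDomain]

lemma exists_isDivDiff_monomial {n : ℕ} {i j : Fin n} (hij : i.val + 1 = j.val)
    {α : Fin n →₀ ℕ} (hα : α ≤ staircase n) {m : ℕ} (hm : ∑ i, α i = m + 1) (h : α j ≤ α i) :
    ∃ d ∈ subStaircase n m, IsDivDiff i j (monomial α 1) d := by
  have hne : i ≠ j := fun e => by rw [e] at hij; omega
  obtain ⟨t, ht⟩ := Nat.exists_eq_add_of_le h
  have hti : t ≤ α i := by omega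
  set γ : Fin n →₀ ℕ := α - Finsupp.single i t with hγ
  have hαγ : α = γ + Finsupp.single i t := by
    ext x
    simp only [hγ, Finsupp.add_apply, Finsupp.tsub_apply, Finsupp.single_apply]
    split_ifs with hx
    · subst hx; omega
    · omega
  have hγi : γ i = α j := by simp [hγ]; omega
  have hγj : γ j = α j := by simp [hγ, hne]
  have hγx : ∀ x, γ x ≤ α x := fun x => by rw [hαγ]; simp
  have hsum : ∑ x, γ x + t = m + 1 := by
    rw [← hm, hαγ]
    simp [Finset.sum_add_distrib]
  refine ⟨∑ s ∈ Finset.range t,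
    monomial (γ + Finsupp.single i s + Finsupp.single j (t - 1 - s)) 1, ?_, ?_⟩
  · refine Submodule.sum_mem _ (fun s hs => Submodule.subset_span ⟨_, ?_, ?_, rfl⟩)
    · rw [Finset.mem_range] at hs
      intro x
      have hx := hα x
      have hi := hα i
      have hj := hα j
      have h2 := hγx x
      simp only [staircase_apply, Finsupp.add_apply, Finsupp.single_apply] at *
      split_ifs with h3 h4 h4
      · exact absurd (h3.trans h4.symm) hne
      · subst h3; omega
      · subst h4; omega
      · omega
    · rw [Finset.mem_range] at hs
      simp only [Finsupp.add_apply, Finsupp.single_apply, Finset.sum_add_distrib,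
        Finset.sum_ite_eq, Finset.mem_univ, if_true]
      omega
  · have hmon : ∀ u v : ℕ, (monomial (γ + Finsupp.single i u + Finsupp.single j v) (1 : ℚ)) =
        monomial γ 1 * (X i ^ u * X j ^ v) := by
      intro u v
      rw [X_pow_eq_monomial, X_pow_eq_monomial, monomial_mul, monomial_mul]
      simp [add_assoc]
    have hsγ : rename (swap i j) (monomial γ (1 : ℚ)) = monomial γ 1 := by
      have : γ.equivMapDomain (swap i j) = γ := by
        ext x
        simp only [Finsupp.equivMapDomain_apply, symm_swap, swap_apply_def]
        split_ifs with h1 h2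
        · rw [h1, hγi, hγj]
        · rw [h2, hγi, hγj]
        · rfl
      rw [rename_swap_monomial, this]
    have hα' : monomial α (1 : ℚ) = monomial γ 1 * X i ^ t := by
      rw [hαγ, X_pow_eq_monomial, monomial_mul, one_mul]
    unfold IsDivDiff
    rw [hα', map_mul, map_pow, hsγ, rename_X, swap_apply_left]
    simp_rw [hmon]
    rw [← Finset.mul_sum]
    linear_combination (monomial γ 1) * (Commute.all (X i : MvPolynomial (Fin n) ℚ) (X j)).geom_sum₂_mul t

lemma exists_isDivDiff {n : ℕ} {i j : Fin n} (hij : i.val + 1 = j.val) {m : ℕ}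
    {p : MvPolynomial (Fin n) ℚ} (hp : p ∈ subStaircase n (m + 1)) :
    ∃ d ∈ subStaircase n m, IsDivDiff i j p d := by
  induction hp using Submodule.span_induction with
  | mem p hp =>
    obtain ⟨α, hα, hm, rfl⟩ := hp
    rcases le_or_gt (α j) (α i) with h | h
    · exact exists_isDivDiff_monomial hij hα hm h
    · have hi := hα i
      have hj := hα j
      simp only [staircase_apply] at hi hj
      have hα' : α.equivMapDomain (swap i j) ≤ staircase n := by
        intro x
        have hx := hα x
        simp only [Finsupp.equivMapDomain_apply, symm_swap, swap_apply_def, staircase_apply] at hx ⊢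
        split_ifs with h1 h2
        · subst h1; omega
        · subst h2; omega
        · exact hx
      have hm' : ∑ x, α.equivMapDomain (swap i j) x = m + 1 := by
        simp only [Finsupp.equivMapDomain_apply, symm_swap]
        rw [← hm]
        exact Equiv.sum_comp (swap i j) α
      obtain ⟨d, hd, hdd⟩ := exists_isDivDiff_monomial hij hα' hm'
        (by simpa [Finsupp.equivMapDomain_apply] using h.le)
      refine ⟨-d, Submodule.neg_mem _ hd, ?_⟩
      unfold IsDivDiff at hdd ⊢
      rw [← rename_swap_monomial, rename_swap_rename_swap] at hdd
      linear_combination -hdd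
  | zero => exact ⟨0, zero_mem _, by simp [IsDivDiff]⟩
  | add x y _ _ hx hy =>
    obtain ⟨d, hd, hdd⟩ := hx
    obtain ⟨e, he, hee⟩ := hy
    refine ⟨d + e, add_mem hd he, ?_⟩
    unfold IsDivDiff at *
    rw [map_add]
    linear_combination hdd + hee
  | smul a x _ hx =>
    obtain ⟨d, hd, hdd⟩ := hx
    refine ⟨a • d, Submodule.smul_mem _ _ hd, ?_⟩
    unfold IsDivDiff at *
    rw [map_smul, mul_smul_comm, hdd, smul_sub]

/-- `(i, j)` is an ascent of `w` at two adjacent positions. -/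
def IsAscent {n : ℕ} (w : Perm (Fin n)) (p : Fin n × Fin n) : Prop :=
  p.1.val + 1 = p.2.val ∧ w p.1 < w p.2

/-- The divided difference of `p`, with value `0` when it does not exist. -/
noncomputable def divDiff {n : ℕ} (i j : Fin n) (p : MvPolynomial (Fin n) ℚ) :
    MvPolynomial (Fin n) ℚ :=
  if h : ∃ d, IsDivDiff i j p d then h.choose else 0

lemma IsDivDiff.divDiff_eq {n : ℕ} {i j : Fin n} (hij : i ≠ j) {p d : MvPolynomial (Fin n) ℚ}
    (hd : IsDivDiff i j p d) : divDiff i j p = d := by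
  have h : ∃ d, IsDivDiff i j p d := ⟨d, hd⟩
  rw [divDiff, dif_pos h]
  exact h.choose_spec.unique hij hd

/-- The Schubert polynomial of `w`, obtained from the staircase monomial of the longest element
by divided differences along some chain of ascents. -/
noncomputable def schubert {n : ℕ} (w : Perm (Fin n)) : MvPolynomial (Fin n) ℚ :=
  if h : ∃ p, IsAscent w p then
    divDiff h.choose.1 h.choose.2 (schubert (w * swap h.choose.1 h.choose.2))
  else monomial (staircase n) 1
termination_by n * n - invCount w
decreasing_by
  have h1 := invCount_mul_swap w h.choose_spec.1 h.choose_spec.2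
  have h2 := invCount_le (w * swap h.choose.1 h.choose.2)
  omega

lemma not_isAscent_revPerm {n : ℕ} (p : Fin n × Fin n) : ¬ IsAscent Fin.revPerm p := by
  rintro ⟨h1, h2⟩
  rw [Fin.revPerm_apply, Fin.revPerm_apply, Fin.rev_lt_rev, Fin.lt_def] at h2
  omega

lemma schubert_revPerm (n : ℕ) :
    schubert (Fin.revPerm : Perm (Fin n)) = monomial (staircase n) 1 := by
  rw [schubert, dif_neg]
  rintro ⟨p, hp⟩
  exact not_isAscent_revPerm p hp

lemma isDivDiff_congr_adjacent {n : ℕ} {w : Perm (Fin n)} {a b c : Fin n}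
    (hab : a.val + 1 = b.val) (hbc : b.val + 1 = c.val) (h1 : w a < w b) (h2 : w b < w c)
    (IH : ∀ v : Perm (Fin n), invCount w < invCount v →
      ∀ i j, IsAscent v (i, j) → IsDivDiff i j (schubert (v * swap i j)) (schubert v))
    {d e : MvPolynomial (Fin n) ℚ} (hd : IsDivDiff a b (schubert (w * swap a b)) d)
    (he : IsDivDiff b c (schubert (w * swap b c)) e) : d = e := by
  have nab : a ≠ b := fun h => by rw [h] at hab; omega
  have nbc : b ≠ c := fun h => by rw [h] at hbc; omega
  have nac : a ≠ c := fun h => by rw [h] at hab; omega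
  have i1 := invCount_mul_swap w hab h1
  have i2 := invCount_mul_swap w hbc h2
  have a1 : IsAscent (w * swap a b) (b, c) :=
    ⟨hbc, by simpa [swap_apply_of_ne_of_ne nac.symm nbc.symm] using h1.trans h2⟩
  have a2 : IsAscent (w * swap b c) (a, b) :=
    ⟨hab, by simpa [swap_apply_of_ne_of_ne nab nac] using h1.trans h2⟩
  have i3 : _ = _ := invCount_mul_swap _ hbc a1.2
  have i4 : _ = _ := invCount_mul_swap _ hab a2.2
  have a3 : IsAscent (w * swap a b * swap b c) (a, b) :=
    ⟨hab, by simpa [swap_apply_of_ne_of_ne nac.symm nbc.symm,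
      swap_apply_of_ne_of_ne nab nac] using h2⟩
  have a4 : IsAscent (w * swap b c * swap a b) (b, c) :=
    ⟨hbc, by simpa [swap_apply_of_ne_of_ne nac.symm nbc.symm,
      swap_apply_of_ne_of_ne nab nac] using h1⟩
  have hu : w * swap a b * swap b c * swap a b = w * swap b c * swap a b * swap b c := by
    simp only [mul_assoc]
    rw [← mul_assoc (swap a b), ← mul_assoc (swap b c), swap_mul_swap_mul_swap nab nac,
      swap_comm a b, swap_comm b c, swap_mul_swap_mul_swap nbc.symm nac.symm, swap_comm a c]
  have k1 := IH _ (by omega) _ _ a3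
  have k2 := IH _ (by omega) _ _ a4
  rw [hu] at k1
  exact IsDivDiff.braid nab nbc nac k1 (IH _ (by omega) _ _ a1) hd
    k2 (IH _ (by omega) _ _ a2) he

lemma isDivDiff_congr_disjoint {n : ℕ} {w : Perm (Fin n)} {a b c d : Fin n}
    (hab : a.val + 1 = b.val) (hcd : c.val + 1 = d.val) (nac : a ≠ c) (nad : a ≠ d) (nbc : b ≠ c)
    (nbd : b ≠ d) (h1 : w a < w b) (h2 : w c < w d)
    (IH : ∀ v : Perm (Fin n), invCount w < invCount v →
      ∀ i j, IsAscent v (i, j) → IsDivDiff i j (schubert (v * swap i j)) (schubert v))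
    {e f : MvPolynomial (Fin n) ℚ} (he : IsDivDiff a b (schubert (w * swap a b)) e)
    (hf : IsDivDiff c d (schubert (w * swap c d)) f) : e = f := by
  have nab : a ≠ b := fun h => by rw [h] at hab; omega
  have ncd : c ≠ d := fun h => by rw [h] at hcd; omega
  have i1 := invCount_mul_swap w hab h1
  have i2 := invCount_mul_swap w hcd h2
  have a1 : IsAscent (w * swap a b) (c, d) :=
    ⟨hcd, by simpa [swap_apply_of_ne_of_ne nac.symm nbc.symm,
      swap_apply_of_ne_of_ne nad.symm nbd.symm] using h2⟩
  have a2 : IsAscent (w * swap c d) (a, b) :=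
    ⟨hab, by simpa [swap_apply_of_ne_of_ne nac nad, swap_apply_of_ne_of_ne nbc nbd] using h1⟩
  have hu : w * swap a b * swap c d = w * swap c d * swap a b := by
    rw [mul_assoc, mul_assoc]
    congr 1
    refine (Perm.Disjoint.commute fun x => ?_).eq
    simp only [swap_apply_def]
    by_cases hx : x = a ∨ x = b
    · right
      rcases hx with rfl | rfl <;> simp_all
    · left
      push Not at hx
      simp [hx.1, hx.2]
  have k1 := IH _ (by omega) _ _ a1
  have k2 := IH _ (by omega) _ _ a2
  rw [hu] at k1
  exact IsDivDiff.commute ncd nab nac.symm nbc.symm nad.symm nbd.symm k1 he k2 hf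

theorem schubert_spec {n : ℕ} (w : Perm (Fin n)) :
    schubert w ∈ subStaircase n (invCount w) ∧
      ∀ i j, IsAscent w (i, j) → IsDivDiff i j (schubert (w * swap i j)) (schubert w) := by
  induction hN : n * n - invCount w using Nat.strong_induction_on generalizing w with
  | _ N IH =>
  have IH' : ∀ v : Perm (Fin n), invCount w < invCount v →
      schubert v ∈ subStaircase n (invCount v) ∧
      ∀ i j, IsAscent v (i, j) → IsDivDiff i j (schubert (v * swap i j)) (schubert v) := by
    intro v hv
    have := invCount_le v
    exact IH _ (by omega) v rfl
  have IH2 := fun v hv => (IH' v hv).2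
  have key : ∀ i j, IsAscent w (i, j) →
      ∃ d ∈ subStaircase n (invCount w), IsDivDiff i j (schubert (w * swap i j)) d := by
    intro i j ha
    have hi : invCount (w * swap i j) = _ := invCount_mul_swap w ha.1 ha.2
    have := (IH' (w * swap i j) (by omega)).1
    rw [hi] at this
    exact exists_isDivDiff ha.1 this
  by_cases h : ∃ p, IsAscent w p
  · have heq : schubert w =
        divDiff h.choose.1 h.choose.2 (schubert (w * swap h.choose.1 h.choose.2)) := by
      rw [schubert, dif_pos h]
    have hp := h.choose_spec
    set p := h.choose
    obtain ⟨a, b⟩ := p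
    obtain ⟨d, hd, hdd⟩ := key a b hp
    have hab := hp.1
    have hlt := hp.2
    simp only at heq hab hlt
    have nab : a ≠ b := fun h => by rw [h] at hab; omega
    rw [hdd.divDiff_eq nab] at heq
    rw [heq]
    refine ⟨hd, fun i j ha => ?_⟩
    obtain ⟨e, he, hee⟩ := key i j ha
    have hij := ha.1
    have hlt' := ha.2
    simp only at hij hlt'
    suffices d = e by rw [this]; exact hee
    by_cases h1 : a = i
    · subst h1
      have : b = j := Fin.ext (by omega)
      subst this
      exact hdd.unique nab hee
    have h2 : b ≠ j := fun h => h1 (Fin.ext (by rw [h] at hab; omega))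
    by_cases h3 : b = i
    · subst h3
      exact isDivDiff_congr_adjacent hab hij hlt hlt' IH2 hdd hee
    by_cases h4 : j = a
    · subst h4
      exact (isDivDiff_congr_adjacent hij hab hlt' hlt IH2 hee hdd).symm
    exact isDivDiff_congr_disjoint hab hij h1 (Ne.symm h4) h3 h2 hlt hlt' IH2 hdd hee
  · refine ⟨?_, fun i j ha => absurd ⟨_, ha⟩ h⟩
    have hw : w = Fin.revPerm := by
      apply eq_revPerm_of_forall_descent
      intro i j hij
      by_contra hlt
      refine h ⟨(i, j), hij, lt_of_le_of_ne (not_lt.mp hlt) fun e => ?_⟩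
      have := w.injective e
      simp only at this
      rw [this] at hij
      omega
    rw [hw, schubert_revPerm]
    exact Submodule.subset_span ⟨_, le_rfl, by simp [invCount_revPerm], rfl⟩

lemma isDivDiff_schubert_of_descent {n : ℕ} {w : Perm (Fin n)} {i j : Fin n}
    (hij : i.val + 1 = j.val) (h : w j < w i) :
    IsDivDiff i j (schubert w) (schubert (w * swap i j)) := by
  have := (schubert_spec (w * swap i j)).2 i j ⟨hij, by simpa using h⟩
  simpa [mul_assoc] using this

lemma isDivDiff_schubert_of_ascent {n : ℕ} {w : Perm (Fin n)} {i j : Fin n}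
    (hij : i.val + 1 = j.val) (h : w i < w j) : IsDivDiff i j (schubert w) 0 := by
  have hne : i ≠ j := fun e => by rw [e] at hij; omega
  exact isDivDiff_zero_iff.mpr (((schubert_spec w).2 i j ⟨hij, h⟩).rename_eq hne)

/-- The reciprocal factorial `1 / z!`, extended by `0` to negative integers. -/
noncomputable def invFactorial (z : ℤ) : ℚ := if z < 0 then 0 else 1 / (z.toNat.factorial : ℚ)

lemma mul_invFactorial (z : ℤ) : (z : ℚ) * invFactorial z = invFactorial (z - 1) := by
  unfold invFactorial
  rcases lt_trichotomy z 0 with h | h | h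
  · rw [if_pos h, if_pos (by omega), mul_zero]
  · subst h; simp
  · obtain ⟨m, rfl⟩ : ∃ m : ℕ, z = m + 1 := ⟨(z - 1).toNat, by omega⟩
    rw [if_neg (by omega), if_neg (by omega)]
    have h1 : ((m : ℤ) + 1).toNat = m + 1 := by omega
    have h2 : ((m : ℤ) + 1 - 1).toNat = m := by omega
    rw [h1, h2, Nat.factorial_succ]
    have : (m.factorial : ℚ) ≠ 0 := by exact_mod_cast m.factorial_ne_zero
    push_cast
    field_simp

/-- The determinant `det (1 / (βᵢ - j)!)`. -/
noncomputable def factorialDet {n : ℕ} (β : Fin n → ℤ) : ℚ :=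
  Matrix.det (Matrix.of fun j i : Fin n => invFactorial (β i - j.val))

lemma factorialDet_comp_swap {n : ℕ} (β : Fin n → ℤ) {i j : Fin n} (hij : i ≠ j) :
    factorialDet (fun x => β (swap i j x)) = - factorialDet β := by
  have := Matrix.det_permute' (swap i j)
    (Matrix.of fun j i : Fin n => invFactorial (β i - j.val))
  rw [Perm.sign_swap hij] at this
  refine Eq.trans rfl (this.trans ?_)
  simp [factorialDet]

lemma factorialDet_eq_zero_of_neg {n : ℕ} {β : Fin n → ℤ} (i : Fin n) (h : β i < 0) :
    factorialDet β = 0 := by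
  refine Matrix.det_eq_zero_of_column_eq_zero i fun j => ?_
  simp only [Matrix.of_apply, invFactorial]
  rw [if_pos (by omega)]

lemma sum_factorialDet_sub_single {n : ℕ} (β : Fin n → ℤ) :
    ∑ k, factorialDet (β - Pi.single k 1) =
      ((∑ i, β i - ∑ i : Fin n, (i.val : ℤ) : ℤ) : ℚ) * factorialDet β := by
  unfold factorialDet
  simp_rw [Matrix.det_apply']
  rw [Finset.sum_comm, Finset.mul_sum]
  refine Finset.sum_congr rfl fun σ _ => ?_
  rw [← Finset.mul_sum, mul_left_comm]
  congr 1
  have hk : ∀ k : Fin n, ∏ i, (Matrix.of fun j i : Fin n =>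
      invFactorial ((β - Pi.single k 1 : Fin n → ℤ) i - j.val)) (σ i) i =
      ((β k - (σ k).val : ℤ) : ℚ) * ∏ i, invFactorial (β i - (σ i).val) := by
    intro k
    simp only [Matrix.of_apply]
    rw [← Finset.mul_prod_erase _ _ (Finset.mem_univ k),
      ← Finset.mul_prod_erase Finset.univ (fun i => invFactorial (β i - (σ i).val))
        (Finset.mem_univ k), ← mul_assoc, mul_invFactorial]
    congr 1
    · simp only [Pi.sub_apply, Pi.single_eq_same]
      congr 1
      ring
    · refine Finset.prod_congr rfl fun i hi => ?_
      simp [Pi.single_eq_of_ne (Finset.ne_of_mem_erase hi)]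
  simp_rw [hk]
  rw [← Finset.sum_mul]
  congr 1
  rw [← Int.cast_sum, Finset.sum_sub_distrib, Equiv.sum_comp σ (fun i => (i.val : ℤ))]

/-- The linear functional sending the monomial `x ^ α` to `det (1 / (αᵢ + γᵢ - j)!)`. -/
noncomputable def factorialFunctional {n : ℕ} (γ : Fin n → ℤ) : MvPolynomial (Fin n) ℚ →ₗ[ℚ] ℚ :=
  (basisMonomials (Fin n) ℚ).constr ℚ (fun α => factorialDet (fun i => (α i : ℤ) + γ i))

lemma factorialFunctional_monomial {n : ℕ} (γ : Fin n → ℤ) (α : Fin n →₀ ℕ) :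
    factorialFunctional γ (monomial α 1) = factorialDet (fun i => (α i : ℤ) + γ i) := by
  have := (basisMonomials (Fin n) ℚ).constr_basis ℚ
    (fun α => factorialDet (fun i => (α i : ℤ) + γ i)) α
  rwa [coe_basisMonomials] at this

lemma factorialFunctional_X_mul {n : ℕ} (γ : Fin n → ℤ) (k : Fin n)
    (q : MvPolynomial (Fin n) ℚ) :
    factorialFunctional γ (X k * q) = factorialFunctional (γ + Pi.single k 1) q := by
  suffices (factorialFunctional γ).comp (LinearMap.mulLeft ℚ (X k)) =
      factorialFunctional (γ + Pi.single k 1) from LinearMap.congr_fun this q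
  refine (basisMonomials (Fin n) ℚ).ext fun α => ?_
  rw [coe_basisMonomials, LinearMap.comp_apply, LinearMap.mulLeft_apply, X, monomial_mul, one_mul,
    factorialFunctional_monomial, factorialFunctional_monomial]
  congr 1
  ext i
  simp only [Finsupp.add_apply, Finsupp.single_apply, Pi.add_apply, Pi.single_apply]
  push_cast
  simp only [eq_comm]
  ring

lemma factorialFunctional_rename_swap {n : ℕ} {γ : Fin n → ℤ} {i j : Fin n} (hij : i ≠ j)
    (hγ : γ i = γ j) (q : MvPolynomial (Fin n) ℚ) :
    factorialFunctional γ (rename (swap i j) q) = - factorialFunctional γ q := by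
  suffices (factorialFunctional γ).comp (rename (swap i j)).toLinearMap =
      - factorialFunctional γ from LinearMap.congr_fun this q
  refine (basisMonomials (Fin n) ℚ).ext fun α => ?_
  rw [coe_basisMonomials, LinearMap.comp_apply, LinearMap.neg_apply, AlgHom.toLinearMap_apply,
    rename_swap_monomial, factorialFunctional_monomial, factorialFunctional_monomial,
    ← factorialDet_comp_swap _ hij]
  congr 1
  ext x
  have : γ (swap i j x) = γ x := by
    rw [swap_apply_def]; split_ifs with h1 h2
    · rw [h1, hγ]
    · rw [h2, hγ]
    · rfl
  rw [this, Finsupp.equivMapDomain_apply, symm_swap]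

/-- The functional `factorialFunctional` at the staircase turns a divided difference into a
shift of one exponent. -/
lemma IsDivDiff.factorialFunctional_eq {n : ℕ} {i j : Fin n} {δ : Fin n → ℤ}
    (hij : i ≠ j) (hδ : δ i = δ j + 1) {p d : MvPolynomial (Fin n) ℚ} (h : IsDivDiff i j p d) :
    factorialFunctional δ d = factorialFunctional (δ - Pi.single i 1) p := by
  set γ := δ - Pi.single i 1 with hγ
  have hγij : γ i = γ j := by simp [hγ, hij.symm, hδ]
  have e := congrArg (factorialFunctional γ) h
  have hXj : X j * d = rename (swap i j) (X i * d) := by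
    rw [map_mul, rename_X, swap_apply_left, h.rename_eq hij]
  rw [sub_mul, map_sub, map_sub, hXj, factorialFunctional_rename_swap hij hγij,
    factorialFunctional_rename_swap hij hγij, factorialFunctional_X_mul, hγ, sub_add_cancel] at e
  linarith

lemma factorialFunctional_euler {n m : ℕ} {p : MvPolynomial (Fin n) ℚ}
    (hp : p ∈ subStaircase n m) :
    ∑ k, factorialFunctional ((fun i => ((staircase n i : ℕ) : ℤ)) - Pi.single k 1) p =
      m * factorialFunctional (fun i => ((staircase n i : ℕ) : ℤ)) p := by
  induction hp using Submodule.span_induction with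
  | mem p hp =>
    obtain ⟨α, hα, hm, rfl⟩ := hp
    simp_rw [factorialFunctional_monomial]
    have := sum_factorialDet_sub_single (fun i => (α i : ℤ) + ((staircase n i : ℕ) : ℤ))
    have hs : ∑ i : Fin n, ((staircase n i : ℕ) : ℤ) = ∑ i : Fin n, (i.val : ℤ) := by
      rw [← Equiv.sum_comp Fin.revPerm]
      refine Finset.sum_congr rfl fun i _ => ?_
      simp only [staircase_apply, Fin.revPerm_apply, Fin.val_rev]
      congr 1
      omega
    rw [Finset.sum_add_distrib, hs, add_sub_cancel_right, ← Nat.cast_sum, hm] at this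
    rw [Int.cast_natCast] at this
    rw [← this]
    refine Finset.sum_congr rfl fun k _ => ?_
    congr 1
    ext i
    simp only [Pi.sub_apply]
    ring
  | zero => simp
  | add x y _ _ hx hy => simp only [map_add, Finset.sum_add_distrib, hx, hy, mul_add]
  | smul a x _ hx =>
    simp only [map_smul, smul_eq_mul, ← Finset.mul_sum, hx]
    ring

lemma factorialFunctional_sub_single_last {n m : ℕ} {p : MvPolynomial (Fin n) ℚ}
    (hp : p ∈ subStaircase n m) (k : Fin n) (hk : k.val = n - 1) :
    factorialFunctional ((fun i => ((staircase n i : ℕ) : ℤ)) - Pi.single k 1) p = 0 := by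
  induction hp using Submodule.span_induction with
  | mem p hp =>
    obtain ⟨α, hα, hm, rfl⟩ := hp
    rw [factorialFunctional_monomial]
    apply factorialDet_eq_zero_of_neg k
    have := hα k
    rw [staircase_apply] at this
    simp only [Pi.sub_apply, Pi.single_eq_same, staircase_apply]
    omega
  | zero => simp
  | add x y _ _ hx hy => rw [map_add, hx, hy, add_zero]
  | smul a x _ hx => rw [map_smul, hx, smul_zero]

/-- The words of length `m` in the letters `1, …, n - 1`. -/
def words (n : ℕ) : ℕ → Finset (List ℕ)
  | 0 => {[]}
  | m + 1 => (Finset.range (n - 1) ×ˢ words n m).image (fun p => (p.1 + 1) :: p.2)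

lemma mem_words {n m : ℕ} {l : List ℕ} :
    l ∈ words n m ↔ l.length = m ∧ ∀ i ∈ l, 1 ≤ i ∧ i ≤ n - 1 := by
  induction m generalizing l with
  | zero =>
    rw [words, Finset.mem_singleton, List.length_eq_zero_iff]
    constructor
    · rintro rfl; simp
    · exact fun h => h.1
  | succ m ih =>
    rw [words, Finset.mem_image]
    constructor
    · rintro ⟨⟨k, t⟩, h, rfl⟩
      rw [Finset.mem_product, Finset.mem_range, ih] at h
      obtain ⟨h1, h2, h3⟩ := h
      simp only at h1 h2 h3
      refine ⟨by simp [h2], ?_⟩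
      intro i hi
      rcases List.mem_cons.mp hi with rfl | hi
      · omega
      · exact h3 i hi
    · rintro ⟨h1, h2⟩
      cases l with
      | nil => simp at h1
      | cons a t =>
        have ha := h2 a (by simp)
        refine ⟨(a - 1, t), ?_, by simp only [List.cons.injEq, and_true]; omega⟩
        rw [Finset.mem_product, Finset.mem_range, ih]
        exact ⟨by simp only; omega, by simpa using h1, fun i hi => h2 i (by simp [hi])⟩

lemma sum_words_succ {M : Type*} [AddCommMonoid M] (n m : ℕ) (F : List ℕ → M) :
    ∑ l ∈ words n (m + 1), F l = ∑ k ∈ Finset.range (n - 1), ∑ t ∈ words n m, F ((k + 1) :: t) := by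
  rw [words, Finset.sum_image, Finset.sum_product]
  rintro ⟨a, s⟩ _ ⟨b, t⟩ _ h
  simpa using h

/-- The number of words of length `m` for `w⁻¹`. -/
def wordCount (n m : ℕ) (w : Perm (Fin n)) : ℕ :=
  ∑ l ∈ words n m, if wordProd n l = w⁻¹ then 1 else 0

lemma simpleRefl_castSucc {N : ℕ} (k : Fin N) :
    simpleRefl (N + 1) (k.val + 1) = swap k.castSucc k.succ := by
  rw [simpleRefl, dif_pos ⟨by omega, by omega⟩]
  rfl

lemma wordProd_cons (n a : ℕ) (t : List ℕ) :
    wordProd n (a :: t) = simpleRefl n a * wordProd n t := by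
  simp [wordProd]

lemma wordProd_cons_eq_inv_iff {N : ℕ} (k : Fin N) (t : List ℕ) (w : Perm (Fin (N + 1))) :
    wordProd (N + 1) ((k.val + 1) :: t) = w⁻¹ ↔
      wordProd (N + 1) t = (w * swap k.castSucc k.succ)⁻¹ := by
  rw [wordProd_cons, simpleRefl_castSucc, mul_inv_rev, swap_inv]
  constructor
  · intro h; rw [← h, ← mul_assoc, swap_mul_self, one_mul]
  · intro h; rw [h, ← mul_assoc, swap_mul_self, one_mul]

lemma wordCount_succ {N m : ℕ} (w : Perm (Fin (N + 1))) :
    wordCount (N + 1) (m + 1) w =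
      ∑ k : Fin N, wordCount (N + 1) m (w * swap k.castSucc k.succ) := by
  rw [wordCount, sum_words_succ, Nat.add_sub_cancel, Finset.sum_range]
  simp only [wordCount, wordProd_cons_eq_inv_iff]

lemma wordCount_eq_zero {N m : ℕ} {w : Perm (Fin (N + 1))} (h : m < invCount w) :
    wordCount (N + 1) m w = 0 := by
  induction m generalizing w with
  | zero =>
    have : w ≠ 1 := by rintro rfl; rw [invCount_one] at h; omega
    rw [wordCount, words, Finset.sum_singleton, if_neg]
    simpa [wordProd, eq_comm] using this
  | succ m ih =>
    rw [wordCount_succ]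
    refine Finset.sum_eq_zero fun k _ => ih ?_
    rcases lt_or_gt_of_ne (w.injective.ne (Fin.castSucc_lt_succ (i := k)).ne) with h1 | h1
    · rw [invCount_mul_swap w (by simp) h1]; omega
    · have := invCount_mul_swap_of_gt w (by simp) h1
      omega

/-- The factorial functional evaluated on the Schubert polynomial of `w`. -/
noncomputable def schubertValue {n : ℕ} (w : Perm (Fin n)) : ℚ :=
  factorialFunctional (fun i => ((staircase n i : ℕ) : ℤ)) (schubert w)

lemma staircase_castSucc {N : ℕ} (k : Fin N) :
    ((staircase (N + 1) k.castSucc : ℕ) : ℤ) = (staircase (N + 1) k.succ : ℕ) + 1 := by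
  rw [staircase_apply, staircase_apply, Fin.val_castSucc, Fin.val_succ]
  omega

lemma schubertValue_mul_swap {N : ℕ} {w : Perm (Fin (N + 1))} (k : Fin N)
    (h : w k.succ < w k.castSucc) :
    schubertValue (w * swap k.castSucc k.succ) = factorialFunctional
      ((fun i => ((staircase (N + 1) i : ℕ) : ℤ)) - Pi.single k.castSucc 1) (schubert w) :=
  (isDivDiff_schubert_of_descent (by simp) h).factorialFunctional_eq
    (Fin.castSucc_lt_succ (i := k)).ne (staircase_castSucc k)

lemma succ_mul_schubertValue {N m : ℕ} {w : Perm (Fin (N + 1))} (h : invCount w = m + 1) :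
    ((m : ℚ) + 1) * schubertValue w = ∑ k : Fin N,
      if w k.succ < w k.castSucc then schubertValue (w * swap k.castSucc k.succ) else 0 := by
  have hw := (schubert_spec w).1
  rw [h] at hw
  have e := factorialFunctional_euler hw
  rw [Fin.sum_univ_castSucc, factorialFunctional_sub_single_last hw _ (by simp), add_zero] at e
  push_cast at e
  rw [schubertValue, ← e]
  refine Finset.sum_congr rfl fun k _ => ?_
  split_ifs with hk
  · exact (schubertValue_mul_swap k hk).symm
  · have hlt : w k.castSucc < w k.succ := lt_of_le_of_ne (not_lt.mp hk)
      (w.injective.ne (Fin.castSucc_lt_succ (i := k)).ne)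
    have := (isDivDiff_schubert_of_ascent (by simp) hlt).factorialFunctional_eq
      (δ := fun i => ((staircase (N + 1) i : ℕ) : ℤ))
      (Fin.castSucc_lt_succ (i := k)).ne (staircase_castSucc k)
    rw [← this, map_zero]

theorem schubertValue_one_mul_wordCount {N m : ℕ} {w : Perm (Fin (N + 1))} (h : invCount w = m) :
    schubertValue (1 : Perm (Fin (N + 1))) * wordCount (N + 1) m w =
      m.factorial * schubertValue w := by
  induction m generalizing w with
  | zero =>
    rw [eq_one_of_invCount_eq_zero h]
    rw [wordCount, words, Finset.sum_singleton, if_pos (by simp [wordProd])]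
    simp
  | succ m ih =>
    rw [wordCount_succ, Nat.factorial_succ, Nat.cast_mul, mul_comm ((m + 1 : ℕ) : ℚ), mul_assoc,
      Nat.cast_succ, succ_mul_schubertValue h, Nat.cast_sum, Finset.mul_sum, Finset.mul_sum]
    refine Finset.sum_congr rfl fun k _ => ?_
    split_ifs with hk
    · have := invCount_mul_swap_of_gt w (by simp) hk
      exact ih (by omega)
    · have hlt : w k.castSucc < w k.succ := lt_of_le_of_ne (not_lt.mp hk)
        (w.injective.ne (Fin.castSucc_lt_succ (i := k)).ne)
      have := invCount_mul_swap w (by simp) hlt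
      rw [wordCount_eq_zero (by omega)]
      simp

lemma schubertValue_revPerm (n : ℕ) :
    schubertValue (Fin.revPerm : Perm (Fin n)) =
      factorialDet (fun i => 2 * ((staircase n i : ℕ) : ℤ)) := by
  rw [schubertValue, schubert_revPerm, factorialFunctional_monomial]
  congr 1
  ext i
  ring

lemma schubert_revPerm_mul_swap {n : ℕ} {i j : Fin n} (hij : i.val + 1 = j.val) :
    schubert (Fin.revPerm * swap i j) = monomial (staircase n - Finsupp.single i 1) 1 := by
  have hne : i ≠ j := fun e => by rw [e] at hij; omega
  have hd : (Fin.revPerm j : Fin n) < Fin.revPerm i := by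
    rw [Fin.revPerm_apply, Fin.revPerm_apply, Fin.rev_lt_rev, Fin.lt_def]; omega
  refine (isDivDiff_schubert_of_descent hij hd).unique hne ?_
  set γ := staircase n - Finsupp.single i 1 with hγ
  have h1 : staircase n = γ + Finsupp.single i 1 := by
    ext x
    simp only [hγ, Finsupp.add_apply, Finsupp.tsub_apply, Finsupp.single_apply, staircase_apply]
    split_ifs with hx
    · subst hx; omega
    · omega
  have h2 : γ.equivMapDomain (swap i j) = γ := by
    ext x
    simp only [hγ, Finsupp.equivMapDomain_apply, symm_swap, swap_apply_def, Finsupp.tsub_apply,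
      Finsupp.single_apply, staircase_apply]
    by_cases hi : x = i
    · subst hi
      rw [if_pos rfl, if_neg hne, if_pos rfl]
      omega
    · by_cases hj : x = j
      · subst hj
        rw [if_neg hi, if_pos rfl, if_pos rfl, if_neg hne]
        omega
      · rw [if_neg hi, if_neg hj]
  have h3 : monomial (staircase n) (1 : ℚ) = monomial γ 1 * X i := by
    rw [h1, X, monomial_mul, one_mul]
  rw [IsDivDiff, schubert_revPerm, h3, map_mul, rename_swap_monomial, h2, rename_X, swap_apply_left]
  ring

lemma schubertValue_revPerm_mul_swap_mul_swap {N : ℕ} {a b : Fin N}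
    (hab : a.val + 1 = b.val ∨ b.val + 1 = a.val) :
    schubertValue (Fin.revPerm * swap a.castSucc a.succ * swap b.castSucc b.succ) =
      factorialDet (fun i => 2 * ((staircase (N + 1) i : ℕ) : ℤ)
        - (Pi.single a.castSucc 1 : Fin (N + 1) → ℤ) i
        - (Pi.single b.castSucc 1 : Fin (N + 1) → ℤ) i) := by
  rw [schubertValue_mul_swap, schubert_revPerm_mul_swap (by simp), factorialFunctional_monomial]
  · congr 1
    ext i
    simp only [Finsupp.tsub_apply, Finsupp.single_apply, Pi.sub_apply, Pi.single_apply,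
      staircase_apply]
    split_ifs <;> simp_all <;> omega
  · simp only [Perm.mul_apply, swap_apply_def, Fin.revPerm_apply, Fin.ext_iff, Fin.val_castSucc,
      Fin.val_succ]
    split_ifs <;> first | omega | (rw [Fin.rev_lt_rev, Fin.lt_def]; simp; omega)

lemma invCount_revPerm_mul_swap_mul_swap {N : ℕ} {a b : Fin N}
    (hab : a.val + 1 = b.val ∨ b.val + 1 = a.val) :
    invCount (Fin.revPerm : Perm (Fin (N + 1))) =
      invCount (Fin.revPerm * swap a.castSucc a.succ * swap b.castSucc b.succ) + 2 := by
  rw [invCount_mul_swap_of_gt Fin.revPerm (i := a.castSucc) (j := a.succ) (by simp),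
    invCount_mul_swap_of_gt (Fin.revPerm * _) (i := b.castSucc) (j := b.succ) (by simp)]
  · simp only [Perm.mul_apply, swap_apply_def, Fin.revPerm_apply, Fin.ext_iff, Fin.val_castSucc,
      Fin.val_succ]
    split_ifs <;> first | omega | (rw [Fin.rev_lt_rev, Fin.lt_def]; simp; omega)
  · rw [Fin.revPerm_apply, Fin.revPerm_apply, Fin.rev_lt_rev]
    exact Fin.castSucc_lt_succ

lemma invFactorial_natCast_sub (b j : ℕ) :
    invFactorial ((b : ℤ) - j) = 1 / (b.factorial : ℚ) * (descPochhammer ℚ j).eval (b : ℚ) := by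
  rw [descPochhammer_eval_eq_descFactorial, invFactorial]
  split_ifs with h
  · rw [Nat.descFactorial_eq_zero_iff_lt.mpr (by omega)]
    simp
  · have hjb : j ≤ b := by omega
    have e : ((b : ℤ) - j).toNat = b - j := by omega
    rw [e, ← Nat.factorial_mul_descFactorial hjb]
    have h1 : ((b - j).factorial : ℚ) ≠ 0 := by exact_mod_cast Nat.factorial_ne_zero _
    have h2 : (b.descFactorial j : ℚ) ≠ 0 := by
      rw [Nat.cast_ne_zero, ne_eq, Nat.descFactorial_eq_zero_iff_lt]
      omega
    push_cast
    field_simp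

lemma factorialDet_natCast (n : ℕ) (b : ℕ → ℕ) :
    factorialDet (fun i : Fin n => (b i : ℤ)) =
      (∏ i ∈ Finset.range n, 1 / ((b i).factorial : ℚ)) *
        ∏ j ∈ Finset.range n, ∏ i ∈ Finset.range j, ((b j : ℚ) - b i) := by
  have h := Matrix.det_eval_matrixOfPolynomials_eq_det_vandermonde
    (fun i : Fin n => (b i : ℚ)) (fun j => descPochhammer ℚ j)
    (fun j => descPochhammer_natDegree ℚ j) (fun j => monic_descPochhammer ℚ j)
  rw [Matrix.det_vandermonde] at h
  rw [factorialDet, ← Matrix.det_transpose]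
  have e : Matrix.transpose (Matrix.of fun j i : Fin n => invFactorial ((b i : ℤ) - j.val)) =
      Matrix.of fun i j : Fin n => 1 / ((b i).factorial : ℚ) *
        Matrix.of (fun i j : Fin n => (descPochhammer ℚ j).eval (b i : ℚ)) i j := by
    ext i j
    exact invFactorial_natCast_sub _ _
  rw [e, Matrix.det_mul_column, ← h, Finset.prod_range, Finset.prod_range]
  congr 1
  rw [Finset.prod_comm' (t' := Finset.univ) (s' := fun j => Finset.Iio j) (by simp)]
  refine Finset.prod_congr rfl fun j _ => ?_
  rw [← Nat.Iio_eq_range, ← Fin.map_valEmbedding_Iio, Finset.prod_map]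
  rfl

/-- The sequence `2N, 2(N - 1), …`, with the entries `k` and `k + 1` decreased by one. -/
def loweredEven (N k i : ℕ) : ℕ := 2 * (N - i) - if i = k ∨ i = k + 1 then 1 else 0

lemma loweredEven_of_ne {N k i : ℕ} (h1 : i ≠ k) (h2 : i ≠ k + 1) :
    loweredEven N k i = 2 * (N - i) := by
  simp [loweredEven, h1, h2]

lemma cast_loweredEven_of_ne {N k i : ℕ} (h1 : i ≠ k) (h2 : i ≠ k + 1) (hi : i ≤ N) :
    (loweredEven N k i : ℚ) = 2 * (N - i) := by
  rw [loweredEven_of_ne h1 h2]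
  push_cast [hi]
  ring

lemma cast_loweredEven_self {N k : ℕ} (hk : k < N) :
    (loweredEven N k k : ℚ) = 2 * (N - k) - 1 := by
  have : loweredEven N k k + 1 = 2 * (N - k) := by simp [loweredEven]; omega
  have := congrArg (Nat.cast (R := ℚ)) this
  push_cast [hk.le] at this
  linarith

lemma cast_loweredEven_succ {N k : ℕ} (hk : k + 1 < N) :
    (loweredEven N k (k + 1) : ℚ) = 2 * (N - (k + 1)) - 1 := by
  have : loweredEven N k (k + 1) + 1 = 2 * (N - (k + 1)) := by simp [loweredEven]; omega
  have := congrArg (Nat.cast (R := ℚ)) this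
  push_cast [hk.le] at this
  linarith

lemma prod_loweredEven_below {N k : ℕ} (hk : k + 1 < N) :
    ∏ j ∈ Finset.range (k + 2), ∏ i ∈ Finset.range j,
        ((loweredEven N k j : ℚ) - loweredEven N k i) =
      (∏ d ∈ Finset.range k, (((2 * d + 3) * (2 * d + 5) : ℚ) / ((2 * d + 2) * (2 * d + 4)))) *
        ∏ j ∈ Finset.range (k + 2), ∏ i ∈ Finset.range j,
          (((2 * (N - j) : ℕ) : ℚ) - (2 * (N - i) : ℕ)) := by
  have e0 : ∏ j ∈ Finset.range k, ∏ i ∈ Finset.range j,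
        ((loweredEven N k j : ℚ) - loweredEven N k i) = ∏ j ∈ Finset.range k,
        ∏ i ∈ Finset.range j, (((2 * (N - j) : ℕ) : ℚ) - (2 * (N - i) : ℕ)) := by
    refine Finset.prod_congr rfl fun j hj => Finset.prod_congr rfl fun i hi => ?_
    rw [Finset.mem_range] at hi hj
    rw [loweredEven_of_ne (by omega) (by omega), loweredEven_of_ne (by omega) (by omega)]
  have e1 : (loweredEven N k (k + 1) : ℚ) - loweredEven N k k =
      ((2 * (N - (k + 1)) : ℕ) : ℚ) - (2 * (N - k) : ℕ) := by
    rw [cast_loweredEven_self (by omega), cast_loweredEven_succ hk]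
    push_cast [hk.le, (show k ≤ N by omega)]
    ring
  have e2 : (∏ i ∈ Finset.range k, ((loweredEven N k k : ℚ) - loweredEven N k i)) *
      ∏ i ∈ Finset.range k, ((loweredEven N k (k + 1) : ℚ) - loweredEven N k i) =
      (∏ d ∈ Finset.range k, (((2 * d + 3) * (2 * d + 5) : ℚ) / ((2 * d + 2) * (2 * d + 4)))) *
      ((∏ i ∈ Finset.range k, (((2 * (N - k) : ℕ) : ℚ) - (2 * (N - i) : ℕ))) *
        ∏ i ∈ Finset.range k, (((2 * (N - (k + 1)) : ℕ) : ℚ) - (2 * (N - i) : ℕ))) := by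
    rw [← Finset.prod_range_reflect (fun d : ℕ =>
      (((2 * d + 3) * (2 * d + 5) : ℚ) / ((2 * d + 2) * (2 * d + 4)))),
      ← Finset.prod_mul_distrib, ← Finset.prod_mul_distrib, ← Finset.prod_mul_distrib]
    refine Finset.prod_congr rfl fun i hi => ?_
    rw [Finset.mem_range] at hi
    obtain ⟨d, rfl⟩ : ∃ d, k = i + 1 + d := ⟨k - i - 1, by omega⟩
    rw [cast_loweredEven_self (by omega), cast_loweredEven_succ hk,
      cast_loweredEven_of_ne (by omega) (by omega) (by omega),
      show i + 1 + d - 1 - i = d by omega]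
    push_cast [hk.le, (show i + 1 + d ≤ N by omega), (show i ≤ N by omega)]
    have h1 : (2 * (d : ℚ) + 2) ≠ 0 := by positivity
    have h2 : (2 * (d : ℚ) + 4) ≠ 0 := by positivity
    field_simp
    ring
  rw [Finset.prod_range_succ _ (k + 1), Finset.prod_range_succ _ k, Finset.prod_range_succ _ k, e0,
    e1, Finset.prod_range_succ _ (k + 1), Finset.prod_range_succ _ k,
    Finset.prod_range_succ (fun i => (((2 * (N - (k + 1)) : ℕ) : ℚ) - (2 * (N - i) : ℕ)))]
  linear_combination (∏ j ∈ Finset.range k,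
        ∏ i ∈ Finset.range j, (((2 * (N - j) : ℕ) : ℚ) - (2 * (N - i) : ℕ))) *
        (((2 * (N - (k + 1)) : ℕ) : ℚ) - (2 * (N - k) : ℕ)) * e2

lemma prod_loweredEven {N k m : ℕ} (hk : k + 1 + m ≤ N) (hk' : k + 1 < N) :
    ∏ j ∈ Finset.range (k + 2 + m), ∏ i ∈ Finset.range j,
        ((loweredEven N k j : ℚ) - loweredEven N k i) =
      (∏ d ∈ Finset.range k, (((2 * d + 3) * (2 * d + 5) : ℚ) / ((2 * d + 2) * (2 * d + 4)))) *
      (∏ t ∈ Finset.range m, (((2 * t + 1) * (2 * t + 3) : ℚ) / ((2 * t + 2) * (2 * t + 4)))) *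
        ∏ j ∈ Finset.range (k + 2 + m), ∏ i ∈ Finset.range j,
          (((2 * (N - j) : ℕ) : ℚ) - (2 * (N - i) : ℕ)) := by
  induction m with
  | zero => simpa using prod_loweredEven_below hk'
  | succ m ih =>
    have e : ∏ i ∈ Finset.range (k + 2 + m),
          ((loweredEven N k (k + 2 + m) : ℚ) - loweredEven N k i) =
        (((2 * m + 1) * (2 * m + 3) : ℚ) / ((2 * m + 2) * (2 * m + 4))) *
        ∏ i ∈ Finset.range (k + 2 + m),
          (((2 * (N - (k + 2 + m)) : ℕ) : ℚ) - (2 * (N - i) : ℕ)) := by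
      have split (f : ℕ → ℚ) : ∏ i ∈ Finset.range (k + 2 + m), f i = (∏ i ∈ Finset.range k, f i) *
          (f k * (f (k + 1) * ∏ i ∈ Finset.Ico (k + 1 + 1) (k + 2 + m), f i)) := by
        rw [← Finset.prod_range_mul_prod_Ico f (show k ≤ k + 2 + m by omega),
          Finset.prod_eq_prod_Ico_succ_bot (by omega) f,
          Finset.prod_eq_prod_Ico_succ_bot (by omega) f]
      rw [split, split]
      have e1 : ∏ i ∈ Finset.range k,
          ((loweredEven N k (k + 2 + m) : ℚ) - loweredEven N k i) = ∏ i ∈ Finset.range k,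
          (((2 * (N - (k + 2 + m)) : ℕ) : ℚ) - (2 * (N - i) : ℕ)) := by
        refine Finset.prod_congr rfl fun i hi => ?_
        rw [Finset.mem_range] at hi
        rw [loweredEven_of_ne (by omega) (by omega), loweredEven_of_ne (by omega) (by omega)]
      have e2 : ∏ i ∈ Finset.Ico (k + 1 + 1) (k + 2 + m),
          ((loweredEven N k (k + 2 + m) : ℚ) - loweredEven N k i) =
          ∏ i ∈ Finset.Ico (k + 1 + 1) (k + 2 + m),
          (((2 * (N - (k + 2 + m)) : ℕ) : ℚ) - (2 * (N - i) : ℕ)) := by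
        refine Finset.prod_congr rfl fun i hi => ?_
        rw [Finset.mem_Ico] at hi
        rw [loweredEven_of_ne (by omega) (by omega), loweredEven_of_ne (by omega) (by omega)]
      have e3 : ((loweredEven N k (k + 2 + m) : ℚ) - loweredEven N k k) *
          ((loweredEven N k (k + 2 + m) : ℚ) - loweredEven N k (k + 1)) =
          (((2 * m + 1) * (2 * m + 3) : ℚ) / ((2 * m + 2) * (2 * m + 4))) *
          ((((2 * (N - (k + 2 + m)) : ℕ) : ℚ) - (2 * (N - k) : ℕ)) *
          (((2 * (N - (k + 2 + m)) : ℕ) : ℚ) - (2 * (N - (k + 1)) : ℕ))) := by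
        rw [cast_loweredEven_self (by omega), cast_loweredEven_succ hk',
          cast_loweredEven_of_ne (by omega) (by omega) (by omega)]
        push_cast [hk'.le, (show k + 2 + m ≤ N by omega), (show k ≤ N by omega)]
        have h1 : (2 * (m : ℚ) + 2) ≠ 0 := by positivity
        have h2 : (2 * (m : ℚ) + 4) ≠ 0 := by positivity
        field_simp
        ring
      rw [e1, e2]
      linear_combination (∏ i ∈ Finset.range k,
          (((2 * (N - (k + 2 + m)) : ℕ) : ℚ) - (2 * (N - i) : ℕ))) *
          (∏ i ∈ Finset.Ico (k + 1 + 1) (k + 2 + m),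
          (((2 * (N - (k + 2 + m)) : ℕ) : ℚ) - (2 * (N - i) : ℕ))) * e3
    rw [← add_assoc, Finset.prod_range_succ _ (k + 2 + m), ih (by omega), e,
      Finset.prod_range_succ _ m, Finset.prod_range_succ _ (k + 2 + m)]
    ring

lemma prod_inv_factorial_loweredEven {N k : ℕ} (hk : k + 1 < N) :
    ∏ i ∈ Finset.range (N + 1), 1 / ((loweredEven N k i).factorial : ℚ) =
      4 * (N - k) * (N - (k + 1)) *
        ∏ i ∈ Finset.range (N + 1), 1 / ((2 * (N - i)).factorial : ℚ) := by
  have key : ∀ i, 1 / ((loweredEven N k i).factorial : ℚ) =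
      (if i = k then (2 * (N - k) : ℚ) else 1) * (if i = k + 1 then (2 * (N - (k + 1)) : ℚ) else 1) *
        (1 / ((2 * (N - i)).factorial : ℚ)) := by
    intro i
    have aux : ∀ c : ℕ, 0 < c → 1 / ((c - 1).factorial : ℚ) = c * (1 / (c.factorial : ℚ)) := by
      intro c hc
      rw [← Nat.mul_factorial_pred hc.ne']
      have h1 : (c : ℚ) ≠ 0 := by exact_mod_cast hc.ne'
      have h2 : ((c - 1).factorial : ℚ) ≠ 0 := by exact_mod_cast Nat.factorial_ne_zero _
      push_cast
      field_simp
    by_cases h1 : i = k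
    · subst h1
      rw [loweredEven, if_pos (Or.inl rfl), aux _ (by omega), if_pos rfl, if_neg (by omega)]
      push_cast [(show i ≤ N by omega)]
      ring
    · by_cases h2 : i = k + 1
      · subst h2
        rw [loweredEven, if_pos (Or.inr rfl), aux _ (by omega), if_neg h1, if_pos rfl]
        push_cast [hk.le]
        ring
      · rw [loweredEven_of_ne h1 h2, if_neg h1, if_neg h2]
        ring
  rw [Finset.prod_congr rfl fun i _ => key i, Finset.prod_mul_distrib, Finset.prod_mul_distrib,
    Finset.prod_ite_eq', Finset.prod_ite_eq', if_pos (by simp; omega), if_pos (by simp; omega)]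
  ring

lemma prod_ratio_below (k : ℕ) :
    ∏ d ∈ Finset.range k, (((2 * d + 3) * (2 * d + 5) : ℚ) / ((2 * d + 2) * (2 * d + 4))) =
      (2 * k + 1).doubleFactorial / k.factorial *
        ((2 * k + 3).doubleFactorial / (k + 1).factorial) / (3 * 4 ^ k) := by
  induction k with
  | zero => simp [Nat.doubleFactorial]
  | succ k ih =>
    rw [Finset.prod_range_succ, ih, show 2 * (k + 1) + 1 = 2 * k + 1 + 2 by ring,
      show 2 * (k + 1) + 3 = 2 * k + 1 + 2 + 2 by ring,
      show 2 * k + 3 = 2 * k + 1 + 2 by ring, Nat.doubleFactorial_add_two (2 * k + 1 + 2),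
      Nat.doubleFactorial_add_two (2 * k + 1), Nat.factorial_succ (k + 1), Nat.factorial_succ k, pow_succ]
    push_cast
    have : (k.factorial : ℚ) ≠ 0 := by exact_mod_cast Nat.factorial_ne_zero _
    field_simp
    ring

lemma prod_ratio_above (p : ℕ) :
    ∏ t ∈ Finset.range (p + 1), (((2 * t + 1) * (2 * t + 3) : ℚ) / ((2 * t + 2) * (2 * t + 4))) =
      (2 * p + 1).doubleFactorial / p.factorial *
        ((2 * p + 3).doubleFactorial / (p + 1).factorial) /
        (4 ^ (p + 1) * ((p + 1) * (p + 2))) := by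
  induction p with
  | zero => simp [Nat.doubleFactorial]; norm_num
  | succ p ih =>
    rw [Finset.prod_range_succ, ih, show 2 * (p + 1) + 1 = 2 * p + 1 + 2 by ring,
      show 2 * (p + 1) + 3 = 2 * p + 1 + 2 + 2 by ring,
      show 2 * p + 3 = 2 * p + 1 + 2 by ring, Nat.doubleFactorial_add_two (2 * p + 1 + 2),
      Nat.doubleFactorial_add_two (2 * p + 1), Nat.factorial_succ (p + 1), Nat.factorial_succ p,
      pow_succ _ (p + 1)]
    push_cast
    have : (p.factorial : ℚ) ≠ 0 := by exact_mod_cast Nat.factorial_ne_zero _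
    field_simp
    ring

lemma factorialDet_two_mul_staircase (N : ℕ) :
    factorialDet (fun i => 2 * ((staircase (N + 1) i : ℕ) : ℤ)) =
      (∏ i ∈ Finset.range (N + 1), 1 / ((2 * (N - i)).factorial : ℚ)) *
        ∏ j ∈ Finset.range (N + 1), ∏ i ∈ Finset.range j,
          (((2 * (N - j) : ℕ) : ℚ) - (2 * (N - i) : ℕ)) := by
  rw [← factorialDet_natCast (N + 1) (fun i => 2 * (N - i))]
  congr 1

lemma factorialDet_two_mul_staircase_ne_zero (N : ℕ) :
    factorialDet (fun i => 2 * ((staircase (N + 1) i : ℕ) : ℤ)) ≠ 0 := by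
  rw [factorialDet_two_mul_staircase]
  refine mul_ne_zero (Finset.prod_ne_zero_iff.mpr fun i _ => ?_)
    (Finset.prod_ne_zero_iff.mpr fun j hj => Finset.prod_ne_zero_iff.mpr fun i hi => ?_)
  · have : ((2 * (N - i)).factorial : ℚ) ≠ 0 := by exact_mod_cast Nat.factorial_ne_zero _
    positivity
  · rw [Finset.mem_range] at hi hj
    rw [sub_ne_zero, ne_eq, Nat.cast_inj]
    omega

theorem factorialDet_lowered {N p : ℕ} {a b : Fin N} (hab : a.val + 1 = b.val)
    (hN : N = a.val + p + 2) :
    factorialDet (fun i => 2 * ((staircase (N + 1) i : ℕ) : ℤ)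
        - (Pi.single a.castSucc 1 : Fin (N + 1) → ℤ) i
        - (Pi.single b.castSucc 1 : Fin (N + 1) → ℤ) i) =
      ((2 * a.val + 1).doubleFactorial / a.val.factorial *
        ((2 * a.val + 3).doubleFactorial / (a.val + 1).factorial) *
        ((2 * p + 1).doubleFactorial / p.factorial) *
        ((2 * p + 3).doubleFactorial / (p + 1).factorial) / (3 * 4 ^ (a.val + p))) *
      factorialDet (fun i => 2 * ((staircase (N + 1) i : ℕ) : ℤ)) := by
  have e : (fun i => 2 * ((staircase (N + 1) i : ℕ) : ℤ)
        - (Pi.single a.castSucc 1 : Fin (N + 1) → ℤ) i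
        - (Pi.single b.castSucc 1 : Fin (N + 1) → ℤ) i) =
      fun i : Fin (N + 1) => ((loweredEven N a.val i.val : ℕ) : ℤ) := by
    ext i
    simp only [staircase_apply, Pi.single_apply, loweredEven, Fin.ext_iff, Fin.val_castSucc, ← hab]
    split_ifs <;> omega
  have hk : a.val + 1 < N := by omega
  rw [e, factorialDet_natCast, prod_inv_factorial_loweredEven hk, factorialDet_two_mul_staircase]
  have hN' : N + 1 = a.val + 2 + (p + 1) := by omega
  have h := prod_loweredEven (N := N) (k := a.val) (m := p + 1) (by omega) hk
  rw [← hN', prod_ratio_below, prod_ratio_above] at h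
  rw [h, pow_add, pow_succ]
  have hNq : (N : ℚ) = a.val + p + 2 := by exact_mod_cast hN
  rw [hNq]
  have : ((p : ℚ) + 1) ≠ 0 := by positivity
  have : ((p : ℚ) + 2) ≠ 0 := by positivity
  field_simp
  ring

lemma revPerm_inv (n : ℕ) : (Fin.revPerm : Perm (Fin n))⁻¹ = Fin.revPerm := by
  ext i
  simp [Perm.inv_def]

/-- The words of length `m` for the longest element. -/
noncomputable def longestWords (n m : ℕ) : Finset (List ℕ) :=
  (words n m).filter (fun l => wordProd n l = Fin.revPerm)

lemma mem_longestWords {n m : ℕ} {l : List ℕ} :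
    l ∈ longestWords n m ↔ IsWordFor n (w₀ n) l ∧ l.length = m := by
  rw [longestWords, Finset.mem_filter, mem_words, IsWordFor, w₀]
  tauto

lemma card_longestWords (n m : ℕ) : (longestWords n m).card = wordCount n m Fin.revPerm := by
  rw [longestWords, Finset.card_filter, wordCount, revPerm_inv]

lemma schubertValue_one_mul_card_longestWords {N m : ℕ}
    (hm : invCount (Fin.revPerm : Perm (Fin (N + 1))) = m) :
    schubertValue (1 : Perm (Fin (N + 1))) * (longestWords (N + 1) m).card =
      m.factorial * factorialDet (fun i => 2 * ((staircase (N + 1) i : ℕ) : ℤ)) := by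
  rw [card_longestWords, schubertValue_one_mul_wordCount hm, schubertValue_revPerm]

lemma schubertValue_one_ne_zero (N : ℕ) : schubertValue (1 : Perm (Fin (N + 1))) ≠ 0 := by
  intro h
  have := schubertValue_one_mul_card_longestWords (N := N) rfl
  rw [h, zero_mul] at this
  exact mul_ne_zero (Nat.cast_ne_zero.mpr (Nat.factorial_ne_zero _))
    (factorialDet_two_mul_staircase_ne_zero N) this.symm

lemma isReducedWordFor_iff {N m : ℕ} (hm : invCount (Fin.revPerm : Perm (Fin (N + 1))) = m)
    {l : List ℕ} :
    IsReducedWordFor (N + 1) (w₀ (N + 1)) l ↔ l ∈ longestWords (N + 1) m := by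
  have hle : ∀ l', IsWordFor (N + 1) (w₀ (N + 1)) l' → m ≤ l'.length := by
    intro l' hl'
    by_contra! hlt
    have h0 := wordCount_eq_zero (hlt.trans_eq hm.symm)
    rw [← card_longestWords, Finset.card_eq_zero] at h0
    exact Finset.notMem_empty l' (h0 ▸ mem_longestWords.mpr ⟨hl', rfl⟩)
  obtain ⟨l₀, hl₀⟩ : (longestWords (N + 1) m).Nonempty := by
    rw [← Finset.card_ne_zero, ← Nat.cast_ne_zero (R := ℚ)]
    intro h
    have := schubertValue_one_mul_card_longestWords hm
    rw [h, mul_zero] at this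
    exact mul_ne_zero (Nat.cast_ne_zero.mpr (Nat.factorial_ne_zero _))
      (factorialDet_two_mul_staircase_ne_zero N) this.symm
  rw [mem_longestWords] at hl₀ ⊢
  constructor
  · rintro ⟨h1, h2⟩
    exact ⟨h1, le_antisymm ((h2 _ hl₀.1).trans_eq hl₀.2) (hle _ h1)⟩
  · rintro ⟨h1, rfl⟩
    exact ⟨h1, hle⟩

lemma revPerm_mul_simpleRefl {n a : ℕ} (h1 : 1 ≤ a) (h2 : a < n) :
    Fin.revPerm * simpleRefl n (n - a) = simpleRefl n a * Fin.revPerm := by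
  rw [simpleRefl, dif_pos ⟨by omega, by omega⟩, simpleRefl, dif_pos ⟨h1, h2⟩,
    mul_swap_eq_swap_mul, swap_comm]
  congr 2 <;> ext <;> simp <;> omega

/-- Moving the first letter of a word for the longest element to the end. -/
def rotateWord (n : ℕ) : List ℕ → List ℕ
  | [] => []
  | a :: t => t ++ [n - a]

lemma rotateWord_mem {n m : ℕ} {l : List ℕ} (h : l ∈ longestWords n m) :
    rotateWord n l ∈ longestWords n m := by
  cases l with
  | nil => exact h
  | cons a t =>
    rw [mem_longestWords] at h ⊢
    obtain ⟨⟨h1, h2⟩, h3⟩ := h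
    have ha := h1 a (by simp)
    refine ⟨⟨?_, ?_⟩, by simpa [rotateWord] using h3⟩
    · intro i hi
      rw [rotateWord, List.mem_append, List.mem_singleton] at hi
      rcases hi with hi | rfl
      · exact h1 i (by simp [hi])
      · omega
    · rw [w₀, wordProd_cons] at h2
      have hs : simpleRefl n a * simpleRefl n a = 1 := by
        rw [simpleRefl]
        split_ifs <;> simp
      have ht : wordProd n t = simpleRefl n a * Fin.revPerm := by
        rw [← h2, ← mul_assoc, hs, one_mul]
      have hr : wordProd n (rotateWord n (a :: t)) = wordProd n t * simpleRefl n (n - a) := by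
        simp [wordProd, rotateWord]
      rw [hr, ht, mul_assoc, revPerm_mul_simpleRefl ha.1 (by omega), ← mul_assoc, hs, one_mul, w₀]

lemma rotateWord_injOn (n m : ℕ) : Set.InjOn (rotateWord n) (longestWords n m) := by
  intro l hl l' hl' h
  rw [Finset.mem_coe, mem_longestWords] at hl hl'
  cases l with
  | nil =>
    have := hl.2.trans hl'.2.symm
    rw [List.length_nil] at this
    exact (List.length_eq_zero_iff.mp this.symm).symm
  | cons a t =>
    cases l' with
    | nil =>
      have := hl.2.trans hl'.2.symm
      simp at this
    | cons b s =>
      obtain ⟨h1, h2⟩ := List.append_inj' h rfl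
      have ha := hl.1.1 a (by simp)
      have hb := hl'.1.1 b (by simp)
      simp only [List.cons.injEq, and_true] at h2
      rw [h1, show a = b by omega]

lemma sum_rotateWord {M : Type*} [AddCommMonoid M] (n m : ℕ) (F : List ℕ → M) :
    ∑ l ∈ longestWords n m, F (rotateWord n l) = ∑ l ∈ longestWords n m, F l :=
  Finset.sum_nbij (rotateWord n) (fun _ => rotateWord_mem) (rotateWord_injOn n m)
    (Finset.surjOn_of_injOn_of_card_le _ (fun _ => rotateWord_mem) (rotateWord_injOn n m) le_rfl)
    fun _ _ => rfl

lemma getD_rotateWord {n k : ℕ} {l : List ℕ} (hk : k + 1 < l.length) :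
    (rotateWord n l).getD k 0 = l.getD (k + 1) 0 := by
  cases l with
  | nil => simp at hk
  | cons a t =>
    rw [List.length_cons] at hk
    rw [rotateWord, List.getD_append _ _ _ _ (by omega), List.getD_cons_succ]

lemma sum_consecutive_letters {M : Type*} [AddCommMonoid M] {n m k : ℕ} (hk : k + 1 < m)
    (F : ℕ → ℕ → M) :
    ∑ l ∈ longestWords n m, F (l.getD k 0) (l.getD (k + 1) 0) =
      ∑ l ∈ longestWords n m, F (l.getD 0 0) (l.getD 1 0) := by
  induction k with
  | zero => rfl
  | succ k ih =>
    rw [← ih (by omega), ← sum_rotateWord n m (fun l => F (l.getD k 0) (l.getD (k + 1) 0))]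
    refine Finset.sum_congr rfl fun l hl => ?_
    have := (mem_longestWords.mp hl).2
    rw [getD_rotateWord (by omega), getD_rotateWord (by omega)]

/-- Letters at distance at most one. -/
def IsClose (a b : ℕ) : Prop := ¬ 1 < |(a : ℤ) - b|

lemma isClose_iff {a b : ℕ} : IsClose a b ↔ a = b ∨ a + 1 = b ∨ b + 1 = a := by
  rw [IsClose, lt_abs]
  omega

lemma sum_commCount (n m : ℕ) :
    ∑ l ∈ longestWords n m, (commCount l : ℚ) = ((m - 1 : ℕ) : ℚ) * ((longestWords n m).card -
      ∑ l ∈ longestWords n m, if IsClose (l.getD 0 0) (l.getD 1 0) then 1 else 0) := by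
  have h : ∀ l ∈ longestWords n m, (commCount l : ℚ) = ∑ k ∈ Finset.range (m - 1),
      (1 - if IsClose (l.getD k 0) (l.getD (k + 1) 0) then (1 : ℚ) else 0) := by
    intro l hl
    rw [commCount, (mem_longestWords.mp hl).2, Finset.card_filter]
    push_cast
    refine Finset.sum_congr rfl fun k _ => ?_
    by_cases hc : 1 < |(l.getD k 0 : ℤ) - (l.getD (k + 1) 0 : ℤ)|
    · rw [if_pos hc, if_neg (show ¬ IsClose _ _ from not_not.mpr hc), sub_zero]
    · rw [if_neg hc, if_pos (show IsClose _ _ from hc), sub_self]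
  rw [Finset.sum_congr rfl h, Finset.sum_comm, Finset.sum_congr rfl fun k hk =>
    sum_consecutive_letters (by rw [Finset.mem_range] at hk; omega)
      (fun a b => 1 - if IsClose a b then (1 : ℚ) else 0)]
  rw [Finset.sum_const, Finset.card_range, Finset.sum_sub_distrib, nsmul_eq_mul]
  simp

lemma sum_isClose_eq {N m : ℕ} :
    (∑ l ∈ longestWords (N + 1) (m + 2), if IsClose (l.getD 0 0) (l.getD 1 0) then (1 : ℚ) else 0) =
      ∑ a : Fin N, ∑ b : Fin N, if IsClose a.val b.val then
        (wordCount (N + 1) m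
          (Fin.revPerm * swap a.castSucc a.succ * swap b.castSucc b.succ) : ℚ) else 0 := by
  rw [longestWords, Finset.sum_filter, sum_words_succ, Nat.add_sub_cancel, Finset.sum_range]
  refine Finset.sum_congr rfl fun a _ => ?_
  rw [sum_words_succ, Nat.add_sub_cancel, Finset.sum_range]
  refine Finset.sum_congr rfl fun b _ => ?_
  have h1 : ∀ t, wordProd (N + 1) ((a.val + 1) :: (b.val + 1) :: t) = Fin.revPerm ↔
      wordProd (N + 1) t =
        (Fin.revPerm * swap a.castSucc a.succ * swap b.castSucc b.succ)⁻¹ := by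
    intro t
    rw [← wordProd_cons_eq_inv_iff, ← wordProd_cons_eq_inv_iff, revPerm_inv]
  have h2 : IsClose (a.val + 1) (b.val + 1) ↔ IsClose a.val b.val := by
    rw [isClose_iff, isClose_iff]
    omega
  simp only [h1, List.getD_cons_zero, List.getD_cons_succ, h2]
  by_cases hc : IsClose a.val b.val
  · simp only [if_pos hc, wordCount, Nat.cast_sum, Nat.cast_ite, Nat.cast_one, Nat.cast_zero]
  · simp only [if_neg hc, ite_self, Finset.sum_const_zero]

lemma sum_adjacent (M : ℕ) (Y : ℕ → ℚ) :
    ∑ a : Fin (M + 1), ∑ b : Fin (M + 1), ((if a.val + 1 = b.val then Y a.val else 0) +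
      if b.val + 1 = a.val then Y b.val else 0) = 2 * ∑ k ∈ Finset.range M, Y k := by
  have h : ∑ a : Fin (M + 1), ∑ b : Fin (M + 1), (if a.val + 1 = b.val then Y a.val else 0) =
      ∑ k ∈ Finset.range M, Y k := by
    rw [← Finset.sum_range (fun a => ∑ b : Fin (M + 1), if a + 1 = b.val then Y a else 0)]
    have h' : ∀ a, (∑ b : Fin (M + 1), if a + 1 = b.val then Y a else 0) =
        if a + 1 < M + 1 then Y a else 0 := by
      intro a
      rw [← Finset.sum_range (fun b => if a + 1 = b then Y a else 0), Finset.sum_ite_eq]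
      simp only [Finset.mem_range]
    rw [Finset.sum_congr rfl fun a _ => h' a, Finset.sum_range_succ, if_neg (by omega), add_zero]
    refine Finset.sum_congr rfl fun a ha => ?_
    rw [Finset.mem_range] at ha
    rw [if_pos (by omega)]
  simp only [Finset.sum_add_distrib]
  rw [h, Finset.sum_comm, h]
  ring

/-- The product of double factorial quotients attached to `k` and `p`. -/
noncomputable def doubleFactorialWeight (k p : ℕ) : ℚ :=
  (2 * k + 1).doubleFactorial / k.factorial *
    ((2 * k + 3).doubleFactorial / (k + 1).factorial) *
    ((2 * p + 1).doubleFactorial / p.factorial) *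
    ((2 * p + 3).doubleFactorial / (p + 1).factorial)

lemma sum_isClose {M m : ℕ} (hm : invCount (Fin.revPerm : Perm (Fin (M + 1 + 1))) = m + 2) :
    ((m : ℚ) + 2) * (m + 1) *
      (∑ l ∈ longestWords (M + 1 + 1) (m + 2),
        if IsClose (l.getD 0 0) (l.getD 1 0) then (1 : ℚ) else 0) =
      2 * (∑ k ∈ Finset.range M, doubleFactorialWeight k (M - 1 - k)) / (3 * 4 ^ (M - 1)) *
        (longestWords (M + 1 + 1) (m + 2)).card := by
  set D := factorialDet (fun i => 2 * ((staircase (M + 1 + 1) i : ℕ) : ℤ)) with hD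
  have hc := schubertValue_one_ne_zero (M + 1)
  set c := schubertValue (1 : Perm (Fin (M + 1 + 1)))
  have hterm : ∀ a b : Fin (M + 1), (c * if IsClose a.val b.val then
        (wordCount (M + 1 + 1) m
          (Fin.revPerm * swap a.castSucc a.succ * swap b.castSucc b.succ) : ℚ) else 0) =
      (if a.val + 1 = b.val then
        m.factorial * (doubleFactorialWeight a.val (M - 1 - a.val) / (3 * 4 ^ (M - 1)) * D) else 0) +
      if b.val + 1 = a.val then
        m.factorial * (doubleFactorialWeight b.val (M - 1 - b.val) / (3 * 4 ^ (M - 1)) * D)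
        else 0 := by
    have hdet : ∀ a b : Fin (M + 1), a.val + 1 = b.val →
        factorialDet (fun i => 2 * ((staircase (M + 1 + 1) i : ℕ) : ℤ)
          - (Pi.single a.castSucc 1 : Fin (M + 1 + 1) → ℤ) i
          - (Pi.single b.castSucc 1 : Fin (M + 1 + 1) → ℤ) i) =
        doubleFactorialWeight a.val (M - 1 - a.val) / (3 * 4 ^ (M - 1)) * D := by
      intro a b hab
      rw [factorialDet_lowered (p := M - 1 - a.val) hab (by omega), doubleFactorialWeight,
        show a.val + (M - 1 - a.val) = M - 1 by omega]
    have hval : ∀ a b : Fin (M + 1), a.val + 1 = b.val ∨ b.val + 1 = a.val →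
        c * (wordCount (M + 1 + 1) m
          (Fin.revPerm * swap a.castSucc a.succ * swap b.castSucc b.succ) : ℚ) =
        m.factorial * factorialDet (fun i => 2 * ((staircase (M + 1 + 1) i : ℕ) : ℤ)
          - (Pi.single a.castSucc 1 : Fin (M + 1 + 1) → ℤ) i
          - (Pi.single b.castSucc 1 : Fin (M + 1 + 1) → ℤ) i) := by
      intro a b hab
      have := invCount_revPerm_mul_swap_mul_swap hab
      rw [schubertValue_one_mul_wordCount (by omega), schubertValue_revPerm_mul_swap_mul_swap hab]
    intro a b
    by_cases h1 : a.val + 1 = b.val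
    · rw [if_pos (isClose_iff.mpr (Or.inr (Or.inl h1))), hval a b (Or.inl h1), hdet a b h1,
        if_pos h1, if_neg (by omega), add_zero]
    · by_cases h2 : b.val + 1 = a.val
      · rw [if_pos (isClose_iff.mpr (Or.inr (Or.inr h2))), hval a b (Or.inr h2), if_neg h1,
          if_pos h2, zero_add, ← hdet b a h2]
        congr 2
        ext i
        ring
      · rw [if_neg h1, if_neg h2, add_zero]
        split_ifs with h3
        · obtain rfl : a = b := Fin.ext (by rw [isClose_iff] at h3; omega)
          rw [mul_assoc, swap_mul_self, mul_one, wordCount_eq_zero (by omega), Nat.cast_zero,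
            mul_zero]
        · rw [mul_zero]
  have hsum := congrArg (c * ·) (sum_isClose_eq (N := M + 1) (m := m))
  simp only [Finset.mul_sum] at hsum
  simp only [hterm] at hsum
  rw [sum_adjacent M (fun k => m.factorial *
    (doubleFactorialWeight k (M - 1 - k) / (3 * 4 ^ (M - 1)) * D)), ← Finset.mul_sum,
    ← Finset.mul_sum, ← Finset.sum_mul, ← Finset.sum_div] at hsum
  have hcard := schubertValue_one_mul_card_longestWords hm
  rw [← hD, Nat.factorial_succ, Nat.factorial_succ] at hcard
  push_cast at hcard
  refine mul_left_cancel₀ hc ?_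
  linear_combination ((m : ℚ) + 2) * (m + 1) * hsum -
    2 * (∑ k ∈ Finset.range M, doubleFactorialWeight k (M - 1 - k)) / (3 * 4 ^ (M - 1)) * hcard

theorem sum_commCount_longestWords {M ℓ : ℕ} (hM : 1 ≤ M) (hℓ : ℓ = (M + 2) * (M + 1) / 2) :
    ∑ l ∈ longestWords (M + 1 + 1) ℓ, (commCount l : ℚ) =
      ((ℓ : ℚ) - 1 - 2 / ℓ * ((∑ k ∈ Finset.range M, doubleFactorialWeight k (M - 1 - k)) /
        (3 * 4 ^ (M - 1)))) * (longestWords (M + 1 + 1) ℓ).card := by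
  have hinv : invCount (Fin.revPerm : Perm (Fin (M + 1 + 1))) = ℓ := by
    rw [invCount_revPerm, sum_staircase, hℓ]
    rfl
  obtain ⟨m, rfl⟩ : ∃ m, ℓ = m + 2 := by
    have : 3 * 2 ≤ (M + 2) * (M + 1) := Nat.mul_le_mul (by omega) (by omega)
    exact ⟨ℓ - 2, by omega⟩
  have h := sum_isClose hinv
  have h1 : ((m : ℚ) + 1) ≠ 0 := by positivity
  have h2 : ((m : ℚ) + 2) ≠ 0 := by positivity
  rw [sum_commCount, show m + 2 - 1 = m + 1 by omega]
  push_cast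
  refine mul_left_cancel₀ h2 ?_
  have e : ((m : ℚ) + 2) * (2 / (m + 2)) = 2 := by field_simp
  linear_combination -h + (∑ k ∈ Finset.range M, doubleFactorialWeight k (M - 1 - k)) /
    (3 * 4 ^ (M - 1)) * (longestWords (M + 1 + 1) (m + 2)).card * e

lemma doubleFactorialWeight_eq {M k : ℕ} (hk : k < M) :
    ((doubleFactorialWeight k (M - 1 - k) : ℚ) : ℝ) =
      ((2 * (1 + k) - 1).doubleFactorial : ℝ) / ((1 + k - 1).factorial : ℝ) *
        (((2 * (1 + k) + 1).doubleFactorial : ℝ) / ((1 + k).factorial : ℝ)) *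
        (((2 * (M + 2) - 2 * (1 + k) - 3).doubleFactorial : ℝ) /
          ((M + 2 - (1 + k) - 2).factorial : ℝ)) *
        (((2 * (M + 2) - 2 * (1 + k) - 1).doubleFactorial : ℝ) /
          ((M + 2 - (1 + k) - 1).factorial : ℝ)) := by
  obtain ⟨p, rfl⟩ : ∃ p, M = k + 1 + p := ⟨M - k - 1, by omega⟩
  rw [show k + 1 + p - 1 - k = p by omega, show 2 * (1 + k) - 1 = 2 * k + 1 by omega,
    show 1 + k - 1 = k by omega, show 2 * (1 + k) + 1 = 2 * k + 3 by ring, add_comm 1 k,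
    show 2 * (k + 1 + p + 2) - 2 * (k + 1) - 3 = 2 * p + 1 by omega,
    show k + 1 + p + 2 - (k + 1) - 2 = p by omega,
    show 2 * (k + 1 + p + 2) - 2 * (k + 1) - 1 = 2 * p + 3 by omega,
    show k + 1 + p + 2 - (k + 1) - 1 = p + 1 by omega, doubleFactorialWeight]
  push_cast
  rfl

end

/-- The sum over all reduced words of `w₀ ∈ S_n` of the number of positions supporting
a commutation equals `E(C_n)` times the number of reduced words of `w₀`, where
`E(C_n) = ℓ - 1 - (1/(3ℓ·2^(2n-7))) ∑_(j=1)^(n-2) [(2j-1)‼/(j-1)!]·[(2j+1)‼/j!]·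
[(2n-2j-3)‼/(n-j-2)!]·[(2n-2j-1)‼/(n-j-1)!]`. -/
theorem expected_commutations (n : ℕ) (hn : 3 ≤ n) (ℓ : ℕ) (hℓ : ℓ = n * (n - 1) / 2) :
    (∑ᶠ l ∈ {l : List ℕ | IsReducedWordFor n (w₀ n) l}, (commCount l : ℝ)) =
      ((ℓ : ℝ) - 1 -
        1 / (3 * (ℓ : ℝ) * (2 : ℝ) ^ ((2 * n : ℤ) - 7)) *
          ∑ j ∈ Finset.Icc 1 (n - 2),
            ((2 * j - 1).doubleFactorial : ℝ) / ((j - 1).factorial : ℝ) *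
              (((2 * j + 1).doubleFactorial : ℝ) / (j.factorial : ℝ)) *
              (((2 * n - 2 * j - 3).doubleFactorial : ℝ) / ((n - j - 2).factorial : ℝ)) *
              (((2 * n - 2 * j - 1).doubleFactorial : ℝ) / ((n - j - 1).factorial : ℝ))) *
        (Nat.card {l : List ℕ // IsReducedWordFor n (w₀ n) l} : ℝ) := by
  obtain ⟨M, rfl⟩ : ∃ M, n = M + 2 := ⟨n - 2, by omega⟩
  have hinv : invCount (Fin.revPerm : Equiv.Perm (Fin (M + 1 + 1))) = ℓ := by
    rw [invCount_revPerm, sum_staircase, hℓ]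
  have hmem : ∀ l, IsReducedWordFor (M + 2) (w₀ (M + 2)) l ↔ l ∈ longestWords (M + 2) ℓ :=
    fun l => isReducedWordFor_iff hinv
  have hsum : (∑ᶠ l ∈ {l : List ℕ | IsReducedWordFor (M + 2) (w₀ (M + 2)) l}, (commCount l : ℝ)) =
      ∑ l ∈ longestWords (M + 2) ℓ, (commCount l : ℝ) := by
    rw [← finsum_mem_coe_finset]
    simp only [Set.mem_ofPred_eq, hmem, Finset.mem_coe]
  have hcard : Nat.card {l : List ℕ // IsReducedWordFor (M + 2) (w₀ (M + 2)) l} =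
      (longestWords (M + 2) ℓ).card := by
    rw [Nat.card_congr (Equiv.subtypeEquivRight hmem), Nat.card_eq_fintype_card,
      Fintype.card_coe]
  have key := congrArg (Rat.cast (K := ℝ)) (sum_commCount_longestWords (by omega) hℓ)
  push_cast at key
  rw [hsum, hcard]
  refine key.trans ?_
  congr 2
  rw [show M + 2 - 2 = M by omega, ← Finset.Ico_add_one_right_eq_Icc, Finset.sum_Ico_eq_sum_range,
    Nat.add_sub_cancel, ← Finset.sum_congr rfl fun k hk =>
      doubleFactorialWeight_eq (Finset.mem_range.mp hk)]
  obtain ⟨q, rfl⟩ : ∃ q, M = q + 1 := ⟨M - 1, by omega⟩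
  rw [show (2 * ((q + 1 + 2 : ℕ) : ℤ) - 7) = ((2 * q : ℕ) : ℤ) - 1 by push_cast; ring,
    zpow_sub_one₀ two_ne_zero, zpow_natCast, pow_mul, Nat.add_sub_cancel]
  norm_num
  ring
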